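/- arXiv:2412.05326 — 5 statements merged into one kernel-verified Lean document; each statement's English description precedes it below -/
import Mathlib

section
/- Let (T_t)_{t∈ℝ} be an ergodic measurable measure-preserving flow on a probability space (X,μ), let f : X → ℝ be integrable with ∫_X f dμ = 0, and let A ⊆ X be a measurable set with μ(A) > 0. Then for μ-almost every x ∈ A with f(x) ≠ 0 there exists a sequence t_k → ∞ such that Φ(t_k, x) := ∫_0^{t_k} f(T_s x) ds = 0 and T_{t_k} x ∈ A for every k. -/
open MeasureTheory Filter
open scoped ENNReal Topology

/-- A jointly measurable flow by measure-preserving maps. -/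
structure IsMeasurePreservingFlow {X : Type*} [MeasurableSpace X] (μ : Measure X)
    (T : ℝ → X → X) : Prop where
  zero : T 0 = id
  add : ∀ s t : ℝ, T (s + t) = T s ∘ T t
  measurePreserving : ∀ t : ℝ, MeasurePreserving (T t) μ μ
  measurable : Measurable fun p : ℝ × X => T p.1 p.2

/-- The integral of `f` along the orbit of `x` up to time `t`. -/
noncomputable def orbitIntegral {X : Type*} (T : ℝ → X → X) (f : X → ℝ) (t : ℝ) (x : X) : ℝ :=
  ∫ s in (0 : ℝ)..t, f (T s x)

/-- The function `f` is integrable on bounded pieces of every orbit. -/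
def OrbitIntegrable {X : Type*} (T : ℝ → X → X) (f : X → ℝ) : Prop :=
  ∀ x a b, IntervalIntegrable (fun s => f (T s x)) volume a b

theorem OrbitIntegrable.continuous {X : Type*} {T : ℝ → X → X} {f : X → ℝ}
    (hf : OrbitIntegrable T f) (x : X) :
    Continuous fun t => orbitIntegral T f t x :=
  intervalIntegral.continuous_primitive (hf x) 0

namespace IsMeasurePreservingFlow

variable {X : Type*} [MeasurableSpace X] {μ : Measure X} {T : ℝ → X → X}

theorem apply_add (hT : IsMeasurePreservingFlow μ T) (s t : ℝ) (x : X) :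
    T (s + t) x = T s (T t x) := by rw [hT.add]; rfl

theorem apply_zero (hT : IsMeasurePreservingFlow μ T) (x : X) : T 0 x = x := by rw [hT.zero]; rfl

theorem measurable_orbit (hT : IsMeasurePreservingFlow μ T) (x : X) :
    Measurable fun s => T s x :=
  hT.measurable.comp (measurable_id.prodMk measurable_const)

theorem orbitIntegral_add (hT : IsMeasurePreservingFlow μ T) {f : X → ℝ}
    (hf : OrbitIntegrable T f) (s t : ℝ) (x : X) :
    orbitIntegral T f (s + t) x = orbitIntegral T f t x + orbitIntegral T f s (T t x) := by
  unfold orbitIntegral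
  simp_rw [← hT.apply_add]
  rw [intervalIntegral.integral_comp_add_right (fun s => f (T s x)), zero_add,
    intervalIntegral.integral_add_adjacent_intervals (hf _ _ _) (hf _ _ _)]

theorem measurable_orbitIntegral (hT : IsMeasurePreservingFlow μ T) {f : X → ℝ}
    (hf : Measurable f) (t : ℝ) : Measurable fun x => orbitIntegral T f t x := by
  have h : StronglyMeasurable fun p : X × ℝ => f (T p.2 p.1) :=
    (hf.comp (hT.measurable.comp measurable_swap)).stronglyMeasurable
  unfold orbitIntegral
  simp only [intervalIntegral]
  exact (h.integral_prod_right' (ν := volume.restrict (Set.Ioc 0 t))).measurable.sub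
    (h.integral_prod_right' (ν := volume.restrict (Set.Ioc t 0))).measurable

theorem orbitIntegrable_of_bounded (hT : IsMeasurePreservingFlow μ T) {f : X → ℝ}
    (hf : Measurable f) {C : ℝ} (hC : ∀ x, ‖f x‖ ≤ C) : OrbitIntegrable T f := by
  intro x a b
  refine (intervalIntegrable_const (c := C)).mono_fun
    (hf.comp (hT.measurable_orbit x)).aestronglyMeasurable ?_
  exact Eventually.of_forall fun s => (hC _).trans (Real.le_norm_self C)

/-- The time an orbit spends in a set, or more generally the orbit integral of a nonnegative
function, averages over the space to its expected value. -/
theorem lintegral_lintegral_orbit [SFinite μ] (hT : IsMeasurePreservingFlow μ T) {g : X → ℝ≥0∞}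
    (hg : Measurable g) (ν : Measure ℝ) [SFinite ν] :
    ∫⁻ x, ∫⁻ s, g (T s x) ∂ν ∂μ = ν Set.univ * ∫⁻ x, g x ∂μ := by
  rw [lintegral_lintegral_swap]
  · simp_rw [(hT.measurePreserving _).lintegral_comp hg]
    rw [lintegral_const, mul_comm]
  · exact (hg.comp (hT.measurable.comp measurable_swap)).aemeasurable

theorem ae_ae_orbit [SFinite μ] (hT : IsMeasurePreservingFlow μ T) {p : X → Prop}
    (hp : ∀ᵐ x ∂μ, p x) : ∀ᵐ x ∂μ, ∀ᵐ s : ℝ, p (T s x) := by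
  have hq : Measure.QuasiMeasurePreserving (fun q : X × ℝ => T q.2 q.1) (μ.prod volume) μ :=
    QuasiMeasurePreserving.prod_of_left (hT.measurable.comp measurable_swap)
      (Eventually.of_forall fun t => (hT.measurePreserving t).quasiMeasurePreserving)
  exact Measure.ae_ae_of_ae_prod (hq.ae hp)

end IsMeasurePreservingFlow

/-- A measurable function with uniformly bounded orbit integrals. -/
structure HasBoundedOrbitIntegrals {X : Type*} [MeasurableSpace X] (T : ℝ → X → X)
    (h : X → ℝ) : Prop where
  measurable : Measurable h
  orbitIntegrable : OrbitIntegrable T h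
  bounded : ∃ K, ∀ t x, |orbitIntegral T h t x| ≤ K

namespace IsMeasurePreservingFlow

variable {X : Type*} [MeasurableSpace X] {μ : Measure X} {T : ℝ → X → X}

theorem hasBoundedOrbitIntegrals_indicator_sub (hT : IsMeasurePreservingFlow μ T) {C : Set X}
    (hC : MeasurableSet C) (τ : ℝ) :
    HasBoundedOrbitIntegrals T fun x =>
      C.indicator (fun _ => (1 : ℝ)) x - (T τ ⁻¹' C).indicator (fun _ => (1 : ℝ)) x := by
  have hu (D : Set X) (x : X) : ‖D.indicator (fun _ => (1 : ℝ)) x‖ ≤ 1 := by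
    simpa using norm_indicator_le_norm_self (s := D) (fun _ : X => (1 : ℝ)) x
  have hm (D : Set X) (hD : MeasurableSet D) : Measurable (D.indicator fun _ => (1 : ℝ)) :=
    measurable_const.indicator hD
  have hCτ : MeasurableSet (T τ ⁻¹' C) := (hT.measurePreserving τ).measurable hC
  have hi (D : Set X) (hD : MeasurableSet D) := hT.orbitIntegrable_of_bounded (hm D hD) (hu D)
  refine ⟨(hm C hC).sub (hm _ hCτ), fun x a b => (hi C hC x a b).sub (hi _ hCτ x a b),
    2 * |τ|, fun t x => ?_⟩
  have h1 : ∀ s, (T τ ⁻¹' C).indicator (fun _ => (1 : ℝ)) (T s x) =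
      C.indicator (fun _ => (1 : ℝ)) (T (s + τ) x) := by
    intro s
    rw [add_comm, hT.apply_add]
    rfl
  unfold orbitIntegral
  rw [intervalIntegral.integral_sub (hi C hC x _ _) (hi _ hCτ x _ _)]
  simp_rw [h1]
  rw [intervalIntegral.integral_comp_add_right (fun s => C.indicator (fun _ => (1 : ℝ)) (T s x)),
    intervalIntegral.integral_interval_sub_interval_comm (hi C hC x _ _) (hi C hC x _ _)
      (hi C hC x _ _)]
  have hb (a b : ℝ) := intervalIntegral.norm_integral_le_of_norm_le_const (a := a) (b := b)
    (f := fun s => C.indicator (fun _ => (1 : ℝ)) (T s x)) (C := 1) fun s _ => hu C _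
  have h2 := hb 0 (0 + τ)
  have h3 := hb t (t + τ)
  simp only [one_mul, zero_add, sub_zero, add_sub_cancel_left] at h2 h3 ⊢
  exact (norm_sub_le _ _).trans ((add_le_add h2 h3).trans_eq (two_mul _).symm)

end IsMeasurePreservingFlow

theorem HasBoundedOrbitIntegrals.zero {X : Type*} [MeasurableSpace X] (T : ℝ → X → X) :
    HasBoundedOrbitIntegrals T fun _ => 0 :=
  ⟨measurable_const, fun _ _ _ => intervalIntegrable_const, 0, by simp [orbitIntegral]⟩

theorem HasBoundedOrbitIntegrals.add {X : Type*} [MeasurableSpace X] {T : ℝ → X → X}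
    {g h : X → ℝ} (hg : HasBoundedOrbitIntegrals T g) (hh : HasBoundedOrbitIntegrals T h) :
    HasBoundedOrbitIntegrals T fun x => g x + h x := by
  obtain ⟨K, hK⟩ := hg.bounded
  obtain ⟨L, hL⟩ := hh.bounded
  refine ⟨hg.measurable.add hh.measurable,
    fun x a b => (hg.orbitIntegrable x a b).add (hh.orbitIntegrable x a b), K + L, fun t x => ?_⟩
  unfold orbitIntegral
  rw [intervalIntegral.integral_add (hg.orbitIntegrable x _ _) (hh.orbitIntegrable x _ _)]
  exact (abs_add_le _ _).trans (add_le_add (hK t x) (hL t x))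

theorem HasBoundedOrbitIntegrals.const_mul {X : Type*} [MeasurableSpace X] {T : ℝ → X → X}
    {h : X → ℝ} (hh : HasBoundedOrbitIntegrals T h) (c : ℝ) :
    HasBoundedOrbitIntegrals T fun x => c * h x := by
  obtain ⟨L, hL⟩ := hh.bounded
  refine ⟨hh.measurable.const_mul c, fun x a b => (hh.orbitIntegrable x a b).const_mul c,
    |c| * L, fun t x => ?_⟩
  unfold orbitIntegral
  rw [intervalIntegral.integral_const_mul, abs_mul]
  exact mul_le_mul_of_nonneg_left (hL t x) (abs_nonneg c)

/-- A flow whose almost invariant measurable sets are null or conull. -/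
structure IsErgodicFlow {X : Type*} [MeasurableSpace X] (μ : Measure X) (T : ℝ → X → X) : Prop
    extends IsMeasurePreservingFlow μ T where
  ergodic : ∀ E : Set X, MeasurableSet E → (∀ t : ℝ, T t ⁻¹' E =ᵐ[μ] E) → μ E = 0 ∨ μ E = 1

namespace IsErgodicFlow

variable {X : Type*} [MeasurableSpace X] {μ : Measure X} [IsProbabilityMeasure μ] {T : ℝ → X → X}

theorem ae_eq_const (hT : IsErgodicFlow μ T) {φ : X → ℝ} (hφ : AEMeasurable φ μ)
    (hinv : ∀ t, φ ∘ T t =ᵐ[μ] φ) : ∃ c, φ =ᵐ[μ] Function.const X c := by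
  obtain ⟨ψ, hψ, hφψ⟩ := hφ
  have hψinv (t : ℝ) : ψ ∘ T t =ᵐ[μ] ψ :=
    ((hφψ.symm.comp_tendsto (hT.measurePreserving t).quasiMeasurePreserving.tendsto_ae).trans
      (hinv t)).trans hφψ
  obtain ⟨c, hc⟩ : ∃ c, ψ =ᵐ[μ] Function.const X c := by
    refine exists_eventuallyEq_const_of_forall_separating MeasurableSet fun U hU => ?_
    rcases hT.ergodic (ψ ⁻¹' U) (hψ hU) fun t => by
      rw [← Set.preimage_comp]
      exact (hψinv t).mono fun x hx => by
        change (ψ (T t x) ∈ U) = (ψ x ∈ U)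
        rw [show ψ (T t x) = ψ x from hx] with h | h
    · exact Or.inr (measure_eq_zero_iff_ae_notMem.1 h)
    · exact Or.inl ((prob_compl_eq_zero_iff (hψ hU)).2 h)
  exact ⟨c, hφψ.trans hc⟩

theorem ae_eq_const_of_forall_setIntegral (hT : IsErgodicFlow μ T) {φ : X → ℝ}
    (hφ : Integrable φ μ)
    (h : ∀ C, MeasurableSet C → ∀ t, ∫ x in T t ⁻¹' C, φ x ∂μ = ∫ x in C, φ x ∂μ) :
    ∃ c, φ =ᵐ[μ] Function.const X c := by
  refine hT.ae_eq_const hφ.aemeasurable fun t => ?_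
  have hi : Integrable (φ ∘ T t) μ := (hT.measurePreserving t).integrable_comp_of_integrable hφ
  refine Integrable.ae_eq_of_forall_setIntegral_eq _ _ hi hφ fun D hD _ => ?_
  have hpre : T t ⁻¹' (T (-t) ⁻¹' D) = D := by
    rw [← Set.preimage_comp, ← hT.add, neg_add_cancel, hT.zero, Set.preimage_id]
  have hD' : MeasurableSet (T (-t) ⁻¹' D) := (hT.measurePreserving (-t)).measurable hD
  have hmp := (hT.measurePreserving t).restrict_preimage hD'
  have hint : Integrable φ (μ.restrict (T (-t) ⁻¹' D)) := hφ.integrableOn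
  have h1 : ∫ x in T t ⁻¹' (T (-t) ⁻¹' D), φ (T t x) ∂μ = ∫ x in T (-t) ⁻¹' D, φ x ∂μ := by
    rw [← hmp.map_eq, integral_map hmp.measurable.aemeasurable]
    rw [hmp.map_eq]
    exact hint.aestronglyMeasurable
  rw [hpre] at h1
  exact h1.trans (h D hD (-t))

theorem exists_hasBoundedOrbitIntegrals_of_memLp_two (hT : IsErgodicFlow μ T) {f : X → ℝ}
    (hf : MemLp f 2 μ) (hf0 : ∫ x, f x ∂μ = 0) {ε : ℝ≥0∞} (hε : ε ≠ 0) :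
    ∃ h, HasBoundedOrbitIntegrals T h ∧ eLpNorm (f - h) 2 μ < ε := by
  have hpre {C : Set X} (hC : MeasurableSet C) (t : ℝ) : MeasurableSet (T t ⁻¹' C) :=
    (hT.measurePreserving t).measurable hC
  let v (C : Set X) (hC : MeasurableSet C) : Lp ℝ 2 μ :=
    indicatorConstLp 2 hC (measure_ne_top μ C) (1 : ℝ)
  let S : Submodule ℝ (Lp ℝ 2 μ) :=
    Submodule.span ℝ {w | ∃ C, ∃ hC : MeasurableSet C, ∃ t, w = v C hC - v _ (hpre hC t)}
  have hS : ∀ w ∈ S, ∃ h, HasBoundedOrbitIntegrals T h ∧ w =ᵐ[μ] h := by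
    intro w hw
    induction hw using Submodule.span_induction with
    | mem w hw =>
      obtain ⟨C, hC, t, rfl⟩ := hw
      refine ⟨_, hT.hasBoundedOrbitIntegrals_indicator_sub hC t, ?_⟩
      filter_upwards [Lp.coeFn_sub (v C hC) (v _ (hpre hC t)),
        indicatorConstLp_coeFn (p := 2) (hs := hC) (hμs := measure_ne_top μ C) (c := (1 : ℝ)),
        indicatorConstLp_coeFn (p := 2) (hs := hpre hC t) (hμs := measure_ne_top μ _)
          (c := (1 : ℝ))] with x h1 h2 h3
      rw [h1, Pi.sub_apply, h2, h3]
    | zero => exact ⟨_, .zero T, Lp.coeFn_zero _ _ _⟩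
    | add u w _ _ hu hw =>
      obtain ⟨g, hg, hug⟩ := hu
      obtain ⟨h, hh, hwh⟩ := hw
      exact ⟨_, hg.add hh, (Lp.coeFn_add u w).trans (hug.add hwh)⟩
    | smul c w _ hw =>
      obtain ⟨h, hh, hwh⟩ := hw
      exact ⟨_, hh.const_mul c, (Lp.coeFn_smul c w).trans (hwh.const_smul c)⟩
  have hmem : hf.toLp f ∈ S.topologicalClosure := by
    rw [← Submodule.orthogonal_orthogonal_eq_closure, Submodule.mem_orthogonal]
    intro φ hφ
    have hφ1 : Integrable φ μ := (Lp.memLp φ).integrable one_le_two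
    obtain ⟨c, hc⟩ := hT.ae_eq_const_of_forall_setIntegral hφ1 fun C hC t => by
      have h1 := (Submodule.mem_orthogonal S φ).1 hφ _ (Submodule.subset_span ⟨C, hC, t, rfl⟩)
      rw [inner_sub_left, L2.inner_indicatorConstLp_one, L2.inner_indicatorConstLp_one] at h1
      linarith
    rw [L2.inner_def]
    calc _ = ∫ x, f x * c ∂μ := by
          refine integral_congr_ae ?_
          filter_upwards [hc, hf.coeFn_toLp] with x h1 h2
          rw [h1, h2]
          rfl
      _ = 0 := by rw [integral_mul_const, hf0, zero_mul]
  have hmem' : hf.toLp f ∈ closure (S : Set (Lp ℝ 2 μ)) := by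
    rwa [← Submodule.topologicalClosure_coe]
  obtain ⟨w, hw, hd⟩ := EMetric.mem_closure_iff.1 hmem' ε (pos_iff_ne_zero.2 hε)
  obtain ⟨h, hh, hwh⟩ := hS w hw
  refine ⟨h, hh, ?_⟩
  rw [Lp.edist_def] at hd
  convert hd using 1
  refine eLpNorm_congr_ae ?_
  filter_upwards [hf.coeFn_toLp, hwh] with x h1 h2
  simp [h1, h2]

/-- In an ergodic flow, functions of mean zero are limits in `L¹` of functions with uniformly
bounded orbit integrals. -/
theorem exists_hasBoundedOrbitIntegrals (hT : IsErgodicFlow μ T) {f : X → ℝ}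
    (hf : Integrable f μ) (hf0 : ∫ x, f x ∂μ = 0) {ε : ℝ} (hε : 0 < ε) :
    ∃ h, HasBoundedOrbitIntegrals T h ∧ ∫⁻ x, ‖f x - h x‖ₑ ∂μ ≤ ENNReal.ofReal ε := by
  have hε3 : 0 < ε / 3 := by positivity
  obtain ⟨g, hfg, hg⟩ := (memLp_one_iff_integrable.2 hf).exists_simpleFunc_eLpNorm_sub_lt
    ENNReal.one_ne_top (ENNReal.ofReal_pos.2 hε3).ne'
  have hg1 : Integrable g μ := memLp_one_iff_integrable.1 hg
  have hg2 : MemLp g 2 μ := SimpleFunc.memLp_of_isFiniteMeasure _ _ _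
  set m := ∫ x, g x ∂μ with hm
  have hmb : ‖m‖ₑ ≤ ENNReal.ofReal (ε / 3) := by
    calc ‖m‖ₑ = ‖∫ x, (f - ⇑g) x ∂μ‖ₑ := by
          rw [integral_sub' hf hg1, hf0, zero_sub, enorm_neg]
      _ ≤ ∫⁻ x, ‖(f - ⇑g) x‖ₑ ∂μ := enorm_integral_le_lintegral_enorm _
      _ ≤ _ := by rw [← eLpNorm_one_eq_lintegral_enorm]; exact hfg.le
  obtain ⟨h, hh, hgh⟩ := hT.exists_hasBoundedOrbitIntegrals_of_memLp_two
    (hg2.sub (memLp_const m)) (by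
      change ∫ x, (g x - m) ∂μ = 0
      rw [integral_sub hg1 (integrable_const m)]; simp [hm]) (ENNReal.ofReal_pos.2 hε3).ne'
  refine ⟨h, hh, ?_⟩
  have hmeas : AEStronglyMeasurable (⇑g - (fun _ : X => m) - h) μ :=
    (g.aestronglyMeasurable.sub aestronglyMeasurable_const).sub
      hh.measurable.aestronglyMeasurable
  have hgh1 := (eLpNorm_le_eLpNorm_of_exponent_le (p := 1) (q := 2) one_le_two hmeas).trans hgh.le
  have hfgm : AEStronglyMeasurable (f - ⇑g) μ := hf.1.sub g.aestronglyMeasurable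
  have hmc : eLpNorm (fun _ : X => m) 1 μ ≤ ENNReal.ofReal (ε / 3) := by
    simpa [eLpNorm_one_eq_lintegral_enorm] using hmb
  calc ∫⁻ x, ‖f x - h x‖ₑ ∂μ
      = eLpNorm (f - ⇑g + (fun _ : X => m) + (⇑g - (fun _ : X => m) - h)) 1 μ := by
        rw [eLpNorm_one_eq_lintegral_enorm]
        congr 1 with x
        simp only [Pi.add_apply, Pi.sub_apply]
        congr 1
        ring
    _ ≤ eLpNorm (f - ⇑g) 1 μ + eLpNorm (fun _ : X => m) 1 μ
          + eLpNorm (⇑g - (fun _ : X => m) - h) 1 μ :=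
        (eLpNorm_add_le (hfgm.add aestronglyMeasurable_const) hmeas le_rfl).trans
          (add_le_add_left (eLpNorm_add_le hfgm aestronglyMeasurable_const le_rfl) _)
    _ ≤ ENNReal.ofReal (ε / 3) + ENNReal.ofReal (ε / 3) + ENNReal.ofReal (ε / 3) :=
        add_le_add (add_le_add hfg.le hmc) hgh1
    _ = ENNReal.ofReal ε := by
        rw [← ENNReal.ofReal_add hε3.le hε3.le, ← ENNReal.ofReal_add (by positivity) hε3.le]
        congr 1
        ring

end IsErgodicFlow

theorem measurableSet_exists_mem_Icc_forall_le {X : Type*} [MeasurableSpace X]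
    {G : ℕ → ℝ → X → ℝ} (hc : ∀ k x, Continuous fun t => G k t x)
    (hm : ∀ k t, Measurable (G k t)) (a b : ℝ) :
    MeasurableSet {x | ∃ t ∈ Set.Icc a b, ∀ k, G k t x ≤ 0} := by
  rcases lt_or_ge b a with hab | hab
  · simp [Set.Icc_eq_empty (not_le.2 hab)]
  have : Nonempty (Set.Icc a b) := ⟨⟨a, le_rfl, hab⟩⟩
  let q : ℕ → Set.Icc a b := TopologicalSpace.denseSeq (Set.Icc a b)
  have hset : {x | ∃ t ∈ Set.Icc a b, ∀ k, G k t x ≤ 0} =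
      ⋂ m : ℕ, ⋃ i : ℕ, ⋂ k ∈ Finset.range m, {x | G k (q i) x < 1 / ((m : ℝ) + 1)} := by
    ext x
    simp only [Set.mem_ofPred_eq, Set.mem_iInter, Set.mem_iUnion, Finset.mem_range]
    constructor
    · rintro ⟨t, ht, htG⟩ m
      have hopen : IsOpen (⋂ k ∈ Finset.range m,
          {u : Set.Icc a b | G k u x < 1 / ((m : ℝ) + 1)}) :=
        isOpen_biInter_finset fun k _ =>
          isOpen_lt ((hc k x).comp continuous_subtype_val) continuous_const
      obtain ⟨i, hi⟩ := (TopologicalSpace.denseRange_denseSeq (Set.Icc a b)).exists_mem_open hopen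
        ⟨⟨t, ht⟩, by
          simp only [Set.mem_iInter, Set.mem_ofPred_eq]
          exact fun k _ => (htG k).trans_lt (by positivity)⟩
      exact ⟨i, by simpa using hi⟩
    · intro h
      choose i hi using h
      obtain ⟨t, ht, φ, hφ, hlim⟩ := isCompact_Icc.tendsto_subseq fun m => (q (i m)).2
      refine ⟨t, ht, fun k => ?_⟩
      have h1 : Tendsto (fun j => G k (q (i (φ j))) x) atTop (𝓝 (G k t x)) :=
        ((hc k x).tendsto t).comp hlim
      have h2 : Tendsto (fun j => 1 / ((φ j : ℝ) + 1)) atTop (𝓝 0) :=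
        (tendsto_one_div_add_atTop_nhds_zero_nat (𝕜 := ℝ)).comp hφ.tendsto_atTop
      refine le_of_tendsto_of_tendsto h1 h2 ?_
      filter_upwards [hφ.tendsto_atTop.eventually_gt_atTop k] with j hj using (hi (φ j) k hj).le
  rw [hset]
  exact .iInter fun m => .iUnion fun i => .biInter (Finset.countable_toSet _) fun k _ =>
    measurableSet_lt (hm k _) measurable_const

/-- The points whose orbit integral moves away from zero at speed at least `δ` during the time
interval `[-δ, δ]`. -/
def expandingSet {X : Type*} (T : ℝ → X → X) (f : X → ℝ) (δ : ℝ) : Set X :=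
  {x | ∀ r ∈ Set.Icc (-δ) δ, δ * |r| ≤ |orbitIntegral T f r x|}

/-- The points returning to `A` within the time window `[a, b]`, with zero orbit integral. -/
def zeroReturnSet {X : Type*} (T : ℝ → X → X) (f : X → ℝ) (A : Set X) (a b : ℝ) : Set X :=
  {x | ∃ t ∈ Set.Icc a b, orbitIntegral T f t x = 0 ∧ T t x ∈ A}

theorem exists_seq_mem_expandingSet_iff {X : Type*} {T : ℝ → X → X} {f : X → ℝ}
    (hf : OrbitIntegrable T f) {δ : ℝ} (hδ : 0 < δ) :
    ∃ r : ℕ → ℝ, ∀ x, x ∈ expandingSet T f δ ↔ ∀ k, δ * |r k| ≤ |orbitIntegral T f (r k) x| := by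
  have : Nonempty (Set.Icc (-δ) δ) := ⟨⟨0, by constructor <;> linarith⟩⟩
  refine ⟨fun k => TopologicalSpace.denseSeq (Set.Icc (-δ) δ) k,
    fun x => ⟨fun h k => h _ (Subtype.property _), fun h r hr => ?_⟩⟩
  have hcl : IsClosed {r : Set.Icc (-δ) δ | δ * |(r : ℝ)| ≤ |orbitIntegral T f r x|} :=
    isClosed_le (by fun_prop) ((hf.continuous x).comp continuous_subtype_val).abs
  exact isClosed_property (TopologicalSpace.denseRange_denseSeq (Set.Icc (-δ) δ)) hcl h ⟨r, hr⟩

theorem lt_of_mem_expandingSet {X : Type*} {T : ℝ → X → X} {f : X → ℝ} {δ : ℝ} (hδ : 0 < δ)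
    {x : X} (hx : x ∈ expandingSet T f δ)
    {t : ℝ} (ht : 0 < t) (h : orbitIntegral T f t x = 0) : δ < t := by
  by_contra! hle
  have := hx t ⟨by linarith, hle⟩
  rw [h, abs_zero, abs_of_pos ht] at this
  nlinarith

namespace IsMeasurePreservingFlow

variable {X : Type*} [MeasurableSpace X] {μ : Measure X} {T : ℝ → X → X} {f : X → ℝ}

theorem measurableSet_expandingSet (hT : IsMeasurePreservingFlow μ T) (hfm : Measurable f)
    (hf : OrbitIntegrable T f) {δ : ℝ} (hδ : 0 < δ) : MeasurableSet (expandingSet T f δ) := by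
  obtain ⟨r, hr⟩ := exists_seq_mem_expandingSet_iff hf hδ
  have h : expandingSet T f δ = ⋂ k, {x | δ * |r k| ≤ |orbitIntegral T f (r k) x|} := by
    ext x
    simp [hr]
  rw [h]
  exact .iInter fun k => measurableSet_le measurable_const (hT.measurable_orbitIntegral hfm _).abs

theorem measurableSet_zeroReturnSet_expandingSet (hT : IsMeasurePreservingFlow μ T)
    (hfm : Measurable f) (hf : OrbitIntegrable T f) {δ : ℝ} (hδ : 0 < δ) (a b : ℝ) :
    MeasurableSet (zeroReturnSet T f (expandingSet T f δ) a b) := by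
  obtain ⟨r, hr⟩ := exists_seq_mem_expandingSet_iff hf hδ
  have h : zeroReturnSet T f (expandingSet T f δ) a b = {x | ∃ t ∈ Set.Icc a b, ∀ k,
      max |orbitIntegral T f t x|
        (δ * |r k| - |orbitIntegral T f (r k + t) x - orbitIntegral T f t x|) ≤ 0} := by
    ext x
    simp only [zeroReturnSet, Set.mem_ofPred_eq, hr, hT.orbitIntegral_add hf, add_sub_cancel_left,
      max_le_iff, abs_nonpos_iff, sub_nonpos, forall_and, forall_const]
  rw [h]
  refine measurableSet_exists_mem_Icc_forall_le (fun k x => ?_) (fun k t => ?_) a b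
  · have h1 := hf.continuous x
    have h2 := h1.comp (continuous_const_add (r k))
    exact h1.abs.max (continuous_const.sub (h2.sub h1).abs)
  · have h1 := hT.measurable_orbitIntegral hfm t
    have h2 := hT.measurable_orbitIntegral hfm (r k + t)
    exact h1.abs.max (measurable_const.sub (h2.sub h1).abs)

theorem measurableSet_zeroReturnSet_inter (hT : IsMeasurePreservingFlow μ T)
    (hfm : Measurable f) (hf : OrbitIntegrable T f) {δ : ℝ} (hδ : 0 < δ) {A : Set X}
    (hA : MeasurableSet A) {a b : ℝ} (hab : b - a ≤ δ) :
    MeasurableSet (zeroReturnSet T f (expandingSet T f δ ∩ A) a b) := by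
  classical
  set D := expandingSet T f δ
  have hH := hT.measurableSet_zeroReturnSet_expandingSet hfm hf hδ
  have huniq : ∀ x, ∀ t ∈ Set.Icc a b, ∀ u ∈ Set.Icc a b, orbitIntegral T f t x = 0 →
      T t x ∈ D → orbitIntegral T f u x = 0 → ¬ t < u := by
    intro x t ht u hu h1 h2 h3 htu
    have h4 := hT.orbitIntegral_add hf (u - t) t x
    rw [sub_add_cancel, h1, h3, zero_add] at h4
    have := lt_of_mem_expandingSet hδ h2 (sub_pos.2 htu) h4.symm
    linarith [ht.1, hu.2]
  have hex : ∀ x, ∃ t, (x ∈ zeroReturnSet T f D a b →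
      t ∈ Set.Icc a b ∧ orbitIntegral T f t x = 0 ∧ T t x ∈ D) ∧
      (x ∉ zeroReturnSet T f D a b → t = a) := fun x => by
    by_cases hx : x ∈ zeroReturnSet T f D a b
    · obtain ⟨t, ht⟩ := hx
      exact ⟨t, fun _ => ht, fun h => (h ⟨t, ht⟩).elim⟩
    · exact ⟨a, fun h => (hx h).elim, fun _ => rfl⟩
  choose σ hσ hσ' using hex
  have huniq' : ∀ x, ∀ t ∈ Set.Icc a b, orbitIntegral T f t x = 0 → T t x ∈ D → σ x = t := by
    intro x t ht h1 h2
    obtain ⟨h3, h4, h5⟩ := hσ x ⟨t, ht, h1, h2⟩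
    exact le_antisymm (not_lt.1 (huniq x t ht _ h3 h1 h2 h4)) (not_lt.1 (huniq x _ h3 t ht h4 h5 h1))
  have hσm : Measurable σ := by
    refine measurable_of_Iic fun c => ?_
    have h : σ ⁻¹' Set.Iic c = zeroReturnSet T f D a (min b c) ∪
        ((zeroReturnSet T f D a b)ᶜ ∩ {_x | a ≤ c}) := by
      ext x
      constructor
      · intro hx
        by_cases hxH : x ∈ zeroReturnSet T f D a b
        · obtain ⟨h1, h2⟩ := hσ x hxH
          exact Or.inl ⟨σ x, ⟨h1.1, le_min h1.2 hx⟩, h2⟩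
        · exact Or.inr ⟨hxH, (hσ' x hxH).symm.trans_le hx⟩
      · rintro (⟨t, ht, h1, h2⟩ | ⟨h1, h2⟩)
        · have := huniq' x t ⟨ht.1, ht.2.trans (min_le_left _ _)⟩ h1 h2
          exact this.trans_le (ht.2.trans (min_le_right _ _))
        · exact (hσ' x h1).trans_le h2
    rw [h]
    exact (hH _ _).union ((hH _ _).compl.inter (.const _))
  have h : zeroReturnSet T f (D ∩ A) a b = zeroReturnSet T f D a b ∩ {x | T (σ x) x ∈ A} := by
    ext x
    constructor
    · rintro ⟨t, ht, h1, h2, h3⟩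
      refine ⟨⟨t, ht, h1, h2⟩, ?_⟩
      rw [Set.mem_ofPred_eq, huniq' x t ht h1 h2]
      exact h3
    · rintro ⟨h1, h2⟩
      obtain ⟨h3, h4, h5⟩ := hσ x h1
      exact ⟨σ x, h3, h4, h5, h2⟩
  rw [h]
  exact (hH _ _).inter ((hT.measurable.comp (hσm.prodMk measurable_id)) hA)

theorem ae_exists_mem_expandingSet [SFinite μ] (hT : IsMeasurePreservingFlow μ T)
    (hfm : Measurable f) (hf : OrbitIntegrable T f) :
    ∀ᵐ x ∂μ, f x ≠ 0 → ∃ n : ℕ, x ∈ expandingSet T f (1 / ((n : ℝ) + 1)) := by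
  set N : Set X := {x | f x = 0}ᶜ ∩ ⋂ n : ℕ, (expandingSet T f (1 / ((n : ℝ) + 1)))ᶜ
  have hNm : MeasurableSet N :=
    (hfm (measurableSet_singleton 0)).compl.inter (.iInter fun n =>
      (hT.measurableSet_expandingSet hfm hf (by positivity)).compl)
  have horb : ∀ x, ∀ᵐ s : ℝ, T s x ∉ N := by
    intro x
    have hloc : LocallyIntegrable (fun s => f (T s x)) volume := fun s =>
      ⟨Set.Icc (s - 1) (s + 1), Icc_mem_nhds (by linarith) (by linarith),
        (intervalIntegrable_iff_integrableOn_Icc_of_le (by linarith)).1 (hf x _ _)⟩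
    filter_upwards [LocallyIntegrable.ae_hasDerivAt_integral hloc] with s hs ⟨h0, hexp⟩
    have hd : HasDerivAt (fun r => orbitIntegral T f r (T s x)) (f (T s x)) 0 := by
      have h1 : HasDerivAt (fun r => orbitIntegral T f (r + s) x) (f (T s x)) 0 := by
        have h2 := hs 0
        rw [← zero_add s] at h2
        have h3 := h2.comp_add_const 0 s
        rwa [zero_add] at h3
      simp_rw [hT.orbitIntegral_add hf] at h1
      simpa using h1.sub_const (orbitIntegral T f s x)
    have hlit := hd.isLittleO
    have hpos : 0 < |f (T s x)| / 2 := by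
      have : 0 < |f (T s x)| := abs_pos.2 h0
      positivity
    obtain ⟨η, hη, hball⟩ := Metric.eventually_nhds_iff.1 (hlit.def hpos)
    obtain ⟨n, hn⟩ := exists_nat_one_div_lt (lt_min hη hpos)
    refine Set.mem_iInter.1 hexp n fun r hr => ?_
    have hr' : |r| ≤ 1 / ((n : ℝ) + 1) := abs_le.2 hr
    have h2 := hball (y := r) (by
      rw [Real.dist_0_eq_abs]
      exact hr'.trans_lt (hn.trans_le (min_le_left _ _)))
    have h3 : orbitIntegral T f 0 (T s x) = 0 := by simp [orbitIntegral]
    rw [h3] at h2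
    simp only [sub_zero, smul_eq_mul, Real.norm_eq_abs] at h2
    have h4 := abs_sub_abs_le_abs_sub (r * f (T s x)) (orbitIntegral T f r (T s x))
    rw [abs_sub_comm, abs_mul] at h4
    have h5 := mul_le_mul_of_nonneg_right (hn.le.trans (min_le_right _ _)) (abs_nonneg r)
    nlinarith
  have hμ := hT.lintegral_lintegral_orbit (g := N.indicator 1) (measurable_one.indicator hNm)
    (volume.restrict (Set.Icc 0 1))
  have hz : ∀ x, ∫⁻ s in Set.Icc (0 : ℝ) 1, N.indicator 1 (T s x) = 0 := by
    intro x
    refine (lintegral_congr_ae ?_).trans lintegral_zero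
    filter_upwards [ae_restrict_of_ae (horb x)] with s hs
    simp [hs]
  simp only [hz, lintegral_zero, lintegral_indicator_one hNm] at hμ
  have hμN : μ N = 0 := by simpa using hμ.symm
  filter_upwards [measure_eq_zero_iff_ae_notMem.1 hμN] with x hx h0
  by_contra! hcon
  exact hx ⟨h0, Set.mem_iInter.2 hcon⟩

end IsMeasurePreservingFlow

theorem ofReal_mul_volume_le_volume_image {F : ℝ → ℝ} {δ : ℝ} (hδ : 0 < δ) {S : Set ℝ}
    (h : ∀ s ∈ S, ∀ t ∈ S, δ * |s - t| ≤ |F s - F t|) :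
    ENNReal.ofReal δ * volume S ≤ volume (F '' S) := by
  have hinj : Set.InjOn F S := fun s hs t ht hst => by
    have := h s hs t ht
    rw [hst, sub_self, abs_zero] at this
    have h1 : |s - t| ≤ 0 := by
      by_contra! hpos
      nlinarith
    exact sub_eq_zero.1 (abs_nonpos_iff.1 h1)
  have hinv : Set.LeftInvOn (Function.invFunOn F S) F S := hinj.leftInvOn_invFunOn
  have hlip : LipschitzOnWith (Real.toNNReal δ⁻¹) (Function.invFunOn F S) (F '' S) := by
    refine LipschitzOnWith.of_dist_le_mul ?_
    rintro _ ⟨s, hs, rfl⟩ _ ⟨t, ht, rfl⟩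
    rw [hinv hs, hinv ht, Real.coe_toNNReal _ (by positivity), Real.dist_eq, Real.dist_eq,
      inv_mul_eq_div, le_div_iff₀ hδ, mul_comm]
    exact h s hs t ht
  have h1 := hlip.hausdorffMeasure_image_le (d := 1) zero_le_one
  rw [hausdorffMeasure_real, hinv.image_image, ENNReal.rpow_one] at h1
  calc ENNReal.ofReal δ * volume S
      ≤ ENNReal.ofReal δ * (ENNReal.ofReal δ⁻¹ * volume (F '' S)) := by gcongr; exact h1
    _ = volume (F '' S) := by
      rw [← mul_assoc, ← ENNReal.ofReal_mul hδ.le, mul_inv_cancel₀ hδ.ne', ENNReal.ofReal_one,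
        one_mul]

theorem ofReal_mul_volume_inter_Ico_le_volume_image {F : ℝ → ℝ} (hF : Continuous F) {δ : ℝ}
    (hδ : 0 < δ) {E : Set ℝ} (hE : MeasurableSet E) (hinj : Set.InjOn F E)
    (h : ∀ s ∈ E, ∀ t ∈ E, |s - t| ≤ δ → δ * |s - t| ≤ |F s - F t|) (M : ℕ) :
    ENNReal.ofReal δ * volume (E ∩ Set.Ico 0 (M * δ)) ≤ volume (F '' (E ∩ Set.Ico 0 (M * δ))) := by
  induction M with
  | zero => simp
  | succ M ih =>
    have hsplit : E ∩ Set.Ico 0 (((M + 1 : ℕ) : ℝ) * δ) =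
        E ∩ Set.Ico 0 (M * δ) ∪ E ∩ Set.Ico (M * δ) (((M + 1 : ℕ) : ℝ) * δ) := by
      rw [← Set.inter_union_distrib_left, Set.Ico_union_Ico_eq_Ico (by positivity)]
      exact mul_le_mul_of_nonneg_right (by push_cast; linarith) hδ.le
    have hdisj : Disjoint (F '' (E ∩ Set.Ico 0 (M * δ)))
        (F '' (E ∩ Set.Ico (M * δ) (((M + 1 : ℕ) : ℝ) * δ))) := by
      rw [Set.disjoint_left]
      rintro _ ⟨s, hs, rfl⟩ ⟨t, ht, hts⟩
      rw [hinj ht.1 hs.1 hts] at ht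
      exact not_lt.2 ht.2.1 hs.2.2
    have hmeas : MeasurableSet (F '' (E ∩ Set.Ico (M * δ) (((M + 1 : ℕ) : ℝ) * δ))) :=
      (hE.inter measurableSet_Ico).image_of_continuousOn_injOn hF.continuousOn
        (hinj.mono Set.inter_subset_left)
    rw [hsplit, Set.image_union, measure_union hdisj hmeas]
    refine (mul_le_mul_right (measure_union_le _ _) _).trans ?_
    rw [mul_add]
    refine add_le_add ih (ofReal_mul_volume_le_volume_image hδ fun s hs t ht =>
      h s hs.1 t ht.1 ?_)
    obtain ⟨h1, h2⟩ := hs.2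
    obtain ⟨h3, h4⟩ := ht.2
    push_cast at h2 h4
    rw [abs_le]
    constructor <;> linarith

theorem volume_image_orbitIntegral_le {X : Type*} [MeasurableSpace X] {T : ℝ → X → X} {f h : X → ℝ}
    (hf : OrbitIntegrable T f) (hh : OrbitIntegrable T h) {K : ℝ} {x : X}
    (hK : ∀ t, |orbitIntegral T h t x| ≤ K) {R : ℝ} (hR : 0 ≤ R) :
    volume ((fun t => orbitIntegral T f t x) '' Set.Ico 0 R) ≤
      ENNReal.ofReal (2 * K) + 2 * ∫⁻ s in Set.Ico 0 R, ‖f (T s x) - h (T s x)‖ₑ := by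
  have hint (a b : ℝ) : IntervalIntegrable (fun s => f (T s x) - h (T s x)) volume a b :=
    (hf x a b).sub (hh x a b)
  set I := ∫ s in (0 : ℝ)..R, |f (T s x) - h (T s x)| with hI
  have hI0 : 0 ≤ I := intervalIntegral.integral_nonneg hR fun s _ => abs_nonneg _
  have hK0 : 0 ≤ K := (abs_nonneg _).trans (hK 0)
  have hsub : (fun t => orbitIntegral T f t x) '' Set.Ico 0 R ⊆ Metric.closedBall 0 (K + I) := by
    rintro _ ⟨t, ht, rfl⟩
    rw [mem_closedBall_zero_iff]
    have h1 : orbitIntegral T f t x =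
        orbitIntegral T h t x + ∫ s in (0 : ℝ)..t, (f (T s x) - h (T s x)) := by
      unfold orbitIntegral
      rw [intervalIntegral.integral_sub (hf x _ _) (hh x _ _)]
      ring
    have h2 : ‖∫ s in (0 : ℝ)..t, (f (T s x) - h (T s x))‖ ≤ I :=
      (intervalIntegral.norm_integral_le_integral_norm ht.1).trans
        (intervalIntegral.integral_mono_interval le_rfl ht.1 ht.2.le
          (Eventually.of_forall fun s => abs_nonneg _) (hint 0 R).abs)
    change ‖orbitIntegral T f t x‖ ≤ _
    rw [h1]
    exact (norm_add_le _ _).trans (add_le_add (hK t) h2)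
  have hIeq : ENNReal.ofReal I = ∫⁻ s in Set.Ico 0 R, ‖f (T s x) - h (T s x)‖ₑ := by
    rw [hI, intervalIntegral.integral_of_le hR, ← restrict_Ico_eq_restrict_Ioc]
    exact ofReal_integral_norm_eq_lintegral_enorm
      ((intervalIntegrable_iff_integrableOn_Ico_of_le hR).1 (hint 0 R))
  calc _ ≤ _ := measure_mono hsub
    _ = ENNReal.ofReal (2 * K) + 2 * ENNReal.ofReal I := by
      rw [Real.volume_closedBall, mul_add, ENNReal.ofReal_add (by positivity) (by positivity),
        ENNReal.ofReal_mul zero_le_two (q := I)]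
      simp
    _ = _ := by rw [hIeq]

namespace IsErgodicFlow

variable {X : Type*} [MeasurableSpace X] {μ : Measure X} [IsProbabilityMeasure μ] {T : ℝ → X → X}
  {f : X → ℝ}

/-- A set of points which never return to it with zero orbit integral is null. -/
theorem measure_eq_zero_of_forall_notMem (hT : IsErgodicFlow μ T) (hfm : Measurable f)
    (hf : OrbitIntegrable T f) (hfi : Integrable f μ) (hf0 : ∫ x, f x ∂μ = 0) {δ : ℝ} (hδ : 0 < δ)
    {B : Set X} (hB : MeasurableSet B) (hBD : B ⊆ expandingSet T f δ)
    (hret : ∀ x ∈ B, ∀ t, 0 < t → orbitIntegral T f t x = 0 → T t x ∉ B) : μ B = 0 := by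
  have hlow (x : X) (M : ℕ) : ENNReal.ofReal δ * volume ({s | T s x ∈ B} ∩ Set.Ico 0 (M * δ)) ≤
      volume ((fun t => orbitIntegral T f t x) '' Set.Ico 0 (M * δ)) := by
    have hdiff (s t : ℝ) : orbitIntegral T f s x - orbitIntegral T f t x =
        orbitIntegral T f (s - t) (T t x) := by
      have := hT.orbitIntegral_add hf (s - t) t x
      rw [sub_add_cancel] at this
      linarith
    have hlt (s t : ℝ) (hs : T s x ∈ B) (ht : T t x ∈ B)
        (h : orbitIntegral T f s x = orbitIntegral T f t x) : ¬ t < s := fun hts => by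
      refine hret _ ht (s - t) (sub_pos.2 hts) (by rw [← hdiff, h, sub_self]) ?_
      rwa [← hT.apply_add, sub_add_cancel]
    refine (ofReal_mul_volume_inter_Ico_le_volume_image (hf.continuous x) hδ
      (hT.measurable_orbit x hB) (fun s hs t ht hst => ?_) (fun s hs t ht hst => ?_) M).trans
      (measure_mono (Set.image_mono Set.inter_subset_right))
    · exact le_antisymm (not_lt.1 (hlt s t hs ht hst)) (not_lt.1 (hlt t s ht hs hst.symm))
    · rw [hdiff]
      exact hBD ht _ (abs_le.1 hst)
  have hmean (ε : ℝ) (hε : 0 < ε) : ∃ K : ℝ, ∀ M : ℕ,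
      δ * (M * δ * μ.real B) ≤ 2 * K + 2 * (M * δ * ε) := by
    obtain ⟨h, hh, hfh⟩ := hT.exists_hasBoundedOrbitIntegrals hfi hf0 hε
    obtain ⟨K, hK⟩ := hh.bounded
    have hK0 : 0 ≤ K := by
      obtain ⟨x⟩ := nonempty_of_isProbabilityMeasure μ
      exact (abs_nonneg _).trans (hK 0 x)
    refine ⟨K, fun M => ?_⟩
    have hR : 0 ≤ M * δ := by positivity
    have hgm : Measurable fun x => ‖f x - h x‖ₑ := (hfm.sub hh.measurable).enorm
    have hBm : Measurable (B.indicator (1 : X → ℝ≥0∞)) := measurable_one.indicator hB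
    have hvol (x : X) : volume ({s | T s x ∈ B} ∩ Set.Ico 0 (M * δ)) =
        ∫⁻ s in Set.Ico 0 (M * δ), B.indicator 1 (T s x) :=
      (Measure.restrict_apply (hT.measurable_orbit x hB)).symm.trans
        (lintegral_indicator_one (hT.measurable_orbit x hB)).symm
    have hvolM : (volume.restrict (Set.Ico 0 (M * δ))) Set.univ = ENNReal.ofReal (M * δ) := by simp
    have hle : ENNReal.ofReal δ * (ENNReal.ofReal (M * δ) * μ B) ≤
        ENNReal.ofReal (2 * K) + 2 * (ENNReal.ofReal (M * δ) * ENNReal.ofReal ε) := by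
      calc ENNReal.ofReal δ * (ENNReal.ofReal (M * δ) * μ B)
          = ∫⁻ x, ENNReal.ofReal δ * volume ({s | T s x ∈ B} ∩ Set.Ico 0 (M * δ)) ∂μ := by
            simp_rw [hvol]
            rw [lintegral_const_mul' _ _ ENNReal.ofReal_ne_top, hT.lintegral_lintegral_orbit hBm,
              lintegral_indicator_one hB, hvolM]
        _ ≤ ∫⁻ x, (ENNReal.ofReal (2 * K) +
              2 * ∫⁻ s in Set.Ico 0 (M * δ), ‖f (T s x) - h (T s x)‖ₑ) ∂μ :=
            lintegral_mono fun x => (hlow x M).trans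
              (volume_image_orbitIntegral_le hf hh.orbitIntegrable (fun t => hK t x) hR)
        _ = ENNReal.ofReal (2 * K) +
              2 * (ENNReal.ofReal (M * δ) * ∫⁻ x, ‖f x - h x‖ₑ ∂μ) := by
            rw [lintegral_add_left measurable_const, lintegral_const_mul' _ _ ENNReal.ofNat_ne_top,
              hT.lintegral_lintegral_orbit hgm, hvolM, lintegral_const, measure_univ, mul_one]
        _ ≤ _ := by gcongr
    rw [← ofReal_measureReal, ← ENNReal.ofReal_mul hR, ← ENNReal.ofReal_mul hδ.le,
      ← ENNReal.ofReal_mul hR, ← ENNReal.ofReal_ofNat 2, ← ENNReal.ofReal_mul zero_le_two,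
      ← ENNReal.ofReal_add (by positivity) (by positivity)] at hle
    exact (ENNReal.ofReal_le_ofReal_iff (by positivity)).1 hle
  by_contra hne
  have hpos : 0 < μ.real B := ENNReal.toReal_pos hne (measure_ne_top μ B)
  obtain ⟨K, hK⟩ := hmean (δ * μ.real B / 4) (by positivity)
  obtain ⟨M, hM⟩ := exists_nat_gt (2 * K / (δ * (δ * μ.real B) / 2))
  rw [div_lt_iff₀ (by positivity)] at hM
  have := hK M
  nlinarith

end IsErgodicFlow

namespace IsErgodicFlow

variable {X : Type*} [MeasurableSpace X] {μ : Measure X} [IsProbabilityMeasure μ] {T : ℝ → X → X}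
  {f : X → ℝ}

theorem ae_frequently_mem_zeroReturnSet (hT : IsErgodicFlow μ T) (hfm : Measurable f)
    (hf : OrbitIntegrable T f) (hfi : Integrable f μ) (hf0 : ∫ x, f x ∂μ = 0) {δ : ℝ}
    (hδ : 0 < δ) {A : Set X} (hA : MeasurableSet A) :
    ∀ᵐ x ∂μ, x ∈ expandingSet T f δ ∩ A → ∃ᶠ j : ℕ in atTop,
      x ∈ zeroReturnSet T f (expandingSet T f δ ∩ A) (j * (δ / 2)) ((j + 1) * (δ / 2)) := by
  set D := expandingSet T f δ ∩ A
  have hDm : MeasurableSet D := (hT.measurableSet_expandingSet hfm hf hδ).inter hA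
  let V (j : ℕ) : Set X := zeroReturnSet T f D (j * (δ / 2)) ((j + 1) * (δ / 2))
  have hVm (j : ℕ) : MeasurableSet (V j) :=
    hT.measurableSet_zeroReturnSet_inter hfm hf hδ hA (by linarith)
  have hV {x : X} {t : ℝ} (ht : 0 ≤ t) (h0 : orbitIntegral T f t x = 0) (hx : T t x ∈ D) :
      x ∈ V ⌊t / (δ / 2)⌋₊ := by
    have hδ2 : 0 < δ / 2 := by positivity
    refine ⟨t, ⟨?_, ?_⟩, h0, hx⟩
    · exact (le_div_iff₀ hδ2).1 (Nat.floor_le (by positivity))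
    · exact ((div_lt_iff₀ hδ2).1 (Nat.lt_floor_add_one _)).le
  let B (j : ℕ) : Set X := D ∩ V j ∩ ⋂ i ∈ Set.Ioi j, (V i)ᶜ
  have hB (j : ℕ) : μ (B j) = 0 := by
    refine hT.measure_eq_zero_of_forall_notMem hfm hf hfi hf0 hδ
      ((hDm.inter (hVm j)).inter (.biInter (Set.to_countable _) fun i _ => (hVm i).compl))
      (fun x hx => hx.1.1.1) fun x hx t ht h0 hy => ?_
    have hδt := lt_of_mem_expandingSet hδ hx.1.1.1 ht h0
    obtain ⟨u, hu, hu0, huD⟩ := hy.1.2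
    have hju : 0 ≤ (j : ℝ) * (δ / 2) := by positivity
    have hadd := hT.orbitIntegral_add hf u t x
    rw [h0, hu0, add_zero] at hadd
    rw [← hT.apply_add] at huD
    have hmem := hV (by linarith [hu.1]) hadd huD
    refine Set.mem_iInter₂.1 hx.2 _ ?_ hmem
    refine Nat.lt_of_succ_le (Nat.le_floor ?_)
    rw [le_div_iff₀ (by positivity)]
    push_cast
    linarith [hu.1]
  filter_upwards [ae_all_iff.2 fun j => measure_eq_zero_iff_ae_notMem.1 (hB j)] with x hx hxD
  rw [Nat.frequently_atTop_iff_infinite]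
  intro hfin
  have hne : {j | x ∈ V j}.Nonempty :=
    ⟨_, hV le_rfl (by simp [orbitIntegral]) (by rwa [hT.apply_zero])⟩
  obtain ⟨j, hj, hmax⟩ := hfin.exists_maximal hne
  refine hx j ⟨⟨hxD, hj⟩, Set.mem_iInter₂.2 fun i hi hxi => ?_⟩
  exact not_le.2 hi (hmax hxi (le_of_lt hi))

theorem ae_exists_seq_of_orbitIntegrable (hT : IsErgodicFlow μ T) (hfm : Measurable f)
    (hf : OrbitIntegrable T f) (hfi : Integrable f μ) (hf0 : ∫ x, f x ∂μ = 0) {A : Set X}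
    (hA : MeasurableSet A) :
    ∀ᵐ x ∂μ, x ∈ A → f x ≠ 0 → ∃ t : ℕ → ℝ, Tendsto t atTop atTop ∧
      ∀ k, orbitIntegral T f (t k) x = 0 ∧ T (t k) x ∈ A := by
  filter_upwards [hT.ae_exists_mem_expandingSet hfm hf, ae_all_iff.2 fun n : ℕ =>
    hT.ae_frequently_mem_zeroReturnSet hfm hf hfi hf0
      (Nat.one_div_pos_of_nat (α := ℝ) (n := n)) hA] with x hx hret hxA h0
  obtain ⟨n, hn⟩ := hx h0
  have hfr := hret n ⟨hn, hxA⟩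
  have hlarge (k : ℕ) : ∃ t : ℝ, k ≤ t ∧ orbitIntegral T f t x = 0 ∧ T t x ∈ A := by
    have hev : ∀ᶠ j : ℕ in atTop, (k : ℝ) ≤ j * (1 / ((n : ℝ) + 1) / 2) :=
      (tendsto_natCast_atTop_atTop.atTop_mul_const (by positivity)).eventually_ge_atTop _
    obtain ⟨j, ⟨t, ht, ht0, htA⟩, hkj⟩ := (hfr.and_eventually hev).exists
    exact ⟨t, hkj.trans ht.1, ht0, htA.2⟩
  choose t ht using hlarge
  exact ⟨t, tendsto_atTop_mono (fun k => (ht k).1) tendsto_natCast_atTop_atTop, fun k => (ht k).2⟩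

/-- An integrable function agrees almost everywhere with a measurable function integrable on
bounded pieces of every orbit. -/
theorem exists_orbitIntegrable_ae_eq (hT : IsErgodicFlow μ T) (hf : Integrable f μ) :
    ∃ g, Measurable g ∧ OrbitIntegrable T g ∧ f =ᵐ[μ] g := by
  set g := hf.1.mk f
  have hgm : Measurable g := hf.1.stronglyMeasurable_mk.measurable
  have hgi : ∫⁻ x, ‖g x‖ₑ ∂μ ≠ ∞ := (hf.congr hf.1.ae_eq_mk).2.ne
  let Y : Set X := ⋂ m : ℕ, {x | ∫⁻ s in Set.Icc (-(m : ℝ)) m, ‖g (T s x)‖ₑ < ∞}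
  have hjoint : Measurable fun p : X × ℝ => ‖g (T p.2 p.1)‖ₑ :=
    (hgm.comp (hT.measurable.comp measurable_swap)).enorm
  have hYm : MeasurableSet Y :=
    .iInter fun m => measurableSet_lt hjoint.lintegral_prod_right' measurable_const
  have hY : ∀ᵐ x ∂μ, x ∈ Y := by
    simp only [Y, Set.mem_iInter]
    refine ae_all_iff.2 fun m => ?_
    refine ae_lt_top hjoint.lintegral_prod_right' ?_
    rw [hT.lintegral_lintegral_orbit hgm.enorm]
    exact ENNReal.mul_ne_top (measure_ne_top _ _) hgi
  have hYint {x : X} (hx : x ∈ Y) (a b : ℝ) :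
      IntervalIntegrable (fun s => g (T s x)) volume a b := by
    obtain ⟨m, hm⟩ := exists_nat_ge (max |a| |b|)
    have hi : IntegrableOn (fun s => g (T s x)) (Set.Icc (-(m : ℝ)) m) :=
      ⟨(hgm.comp (hT.measurable_orbit x)).aestronglyMeasurable, Set.mem_iInter.1 hx m⟩
    refine IntegrableOn.intervalIntegrable (hi.mono_set (Set.uIcc_subset_Icc ?_ ?_))
    · exact abs_le.1 ((le_max_left _ _).trans hm)
    · exact abs_le.1 ((le_max_right _ _).trans hm)
  have hYT {x : X} {t : ℝ} (hx : T t x ∈ Y) : x ∈ Y := by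
    refine Set.mem_iInter.2 fun m => ?_
    have hi := (hYint hx (-m - t) (m - t)).comp_sub_right t
    simp only [← hT.apply_add, sub_add_cancel] at hi
    exact ((intervalIntegrable_iff_integrableOn_Icc_of_le (by simp)).1 hi).2
  refine ⟨Y.indicator g, hgm.indicator hYm, fun x a b => ?_, ?_⟩
  · by_cases hx : x ∈ Y
    · have hTx (s : ℝ) : T s x ∈ Y := hYT (t := -s) (by
        rwa [← hT.apply_add, neg_add_cancel, hT.apply_zero])
      simpa only [Set.indicator_of_mem (hTx _)] using hYint hx a b
    · have hTx (s : ℝ) : T s x ∉ Y := fun h => hx (hYT h)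
      simp only [Set.indicator_of_notMem (hTx _)]
      exact intervalIntegrable_const
  · filter_upwards [hf.1.ae_eq_mk, hY] with x hx hxY
    rw [Set.indicator_of_mem hxY, hx]

end IsErgodicFlow

/-- Theorem 1: for an ergodic measure-preserving flow `T` on a probability space,
an integrable `f` with zero mean, and a set `A` of positive measure, for a.e. `x ∈ A`
with `f x ≠ 0` there is a sequence `t k → ∞` with `∫_0^{t k} f(T_s x) ds = 0` and
`T_{t k} x ∈ A`. -/
theorem integral_zeros_return_to_A
    {X : Type*} [MeasurableSpace X] (μ : Measure X) [IsProbabilityMeasure μ]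
    (T : ℝ → X → X)
    (hT0 : T 0 = id)
    (hTadd : ∀ s t : ℝ, T (s + t) = T s ∘ T t)
    (hTmp : ∀ t : ℝ, MeasurePreserving (T t) μ μ)
    (hTmeas : Measurable fun p : ℝ × X => T p.1 p.2)
    (hTerg : ∀ E : Set X, MeasurableSet E → (∀ t : ℝ, T t ⁻¹' E =ᵐ[μ] E) →
      μ E = 0 ∨ μ E = 1)
    (f : X → ℝ) (hf : Integrable f μ) (hf0 : ∫ x, f x ∂μ = 0)
    (A : Set X) (hA : MeasurableSet A) (hApos : 0 < μ A) :
    ∀ᵐ x ∂μ, x ∈ A → f x ≠ 0 →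
      ∃ t : ℕ → ℝ, Tendsto t atTop atTop ∧
        ∀ k : ℕ, (∫ s in (0:ℝ)..(t k), f (T s x)) = 0 ∧ T (t k) x ∈ A := by
  have hT : IsErgodicFlow μ T := ⟨⟨hT0, hTadd, hTmp, hTmeas⟩, hTerg⟩
  obtain ⟨g, hgm, hg, hfg⟩ := hT.exists_orbitIntegrable_ae_eq hf
  filter_upwards [hT.ae_exists_seq_of_orbitIntegrable hgm hg (hf.congr hfg)
    ((integral_congr_ae hfg).symm.trans hf0) hA, hfg, hT.ae_ae_orbit hfg] with x hx hfgx horb hxA h0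
  obtain ⟨t, ht, htk⟩ := hx hxA (hfgx ▸ h0)
  refine ⟨t, ht, fun k => ⟨?_, (htk k).2⟩⟩
  rw [intervalIntegral.integral_congr_ae (horb.mono fun s hs _ => hs)]
  exact (htk k).1
end

section
/- Let (T_t)_{t∈ℝ} be an ergodic measurable measure-preserving flow on a probability space (X,μ) and let f : X → ℝ be integrable with ∫_X f dμ = 0. Then for every measurable set A ⊆ {x : f(x) ≠ 0} with μ(A) > 0 and every natural number N there exist a point x ∈ X and real numbers t_1 ≥ 0 and t > N such that Φ(t_1, x) = Φ(t_1 + t, x), T_{t_1} x ∈ A and T_{t_1 + t} x ∈ A. -/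
open MeasureTheory Filter

open scoped ENNReal NNReal Topology

/-- A jointly measurable measure-preserving action of `ℝ`. -/
structure IsMeasurableFlow {X : Type*} [MeasurableSpace X] (T : ℝ → X → X) (μ : Measure X) :
    Prop where
  zero : T 0 = id
  add : ∀ s t : ℝ, T (s + t) = T s ∘ T t
  measurePreserving : ∀ t : ℝ, MeasurePreserving (T t) μ μ
  measurable : Measurable fun p : ℝ × X => T p.1 p.2

/-- The orbit integrals of `f` are bounded, up to a constant, by the orbit integrals of
functions with arbitrarily small integral. -/
def HasSmallOrbitIntegrals {X : Type*} [MeasurableSpace X] (T : ℝ → X → X) (μ : Measure X)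
    (f : X → ℝ) : Prop :=
  ∀ ε : ℝ≥0∞, 0 < ε → ∃ (C : ℝ≥0) (e : X → ℝ≥0∞), Measurable e ∧ ∫⁻ x, e x ∂μ ≤ ε ∧
    ∀ᵐ x ∂μ, ∀ s : ℝ, 0 ≤ s →
      ‖∫ r in (0:ℝ)..s, f (T r x)‖ₑ ≤ C + ∫⁻ r in Set.Ioc 0 s, e (T r x)

namespace IsMeasurableFlow

variable {X : Type*} [MeasurableSpace X] {T : ℝ → X → X} {μ : Measure X}

theorem apply_add (hT : IsMeasurableFlow T μ) (s t : ℝ) (x : X) : T (s + t) x = T s (T t x) := by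
  rw [hT.add]; rfl

theorem apply_zero (hT : IsMeasurableFlow T μ) (x : X) : T 0 x = x := by
  rw [hT.zero]; rfl

theorem measurable_orbit (hT : IsMeasurableFlow T μ) (x : X) : Measurable fun r => T r x :=
  hT.measurable.comp measurable_prodMk_right

theorem measurable_comp_orbit {Y : Type*} [MeasurableSpace Y] (hT : IsMeasurableFlow T μ)
    {g : X → Y} (hg : Measurable g) (x : X) : Measurable fun r => g (T r x) :=
  hg.comp (hT.measurable_orbit x)

theorem ae_orbit [SFinite μ] (hT : IsMeasurableFlow T μ) {p : X → Prop} (hp : ∀ᵐ x ∂μ, p x) :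
    ∀ᵐ x ∂μ, ∀ᵐ r : ℝ, p (T r x) := by
  obtain ⟨s, hs, hsm, hμ⟩ := exists_measurable_superset_of_null (ae_iff.1 hp)
  have h : ∀ᵐ x ∂μ, ∀ᵐ r : ℝ, T r x ∉ s := by
    rw [← Measure.ae_ae_comm (p := fun r x => T r x ∉ s) (hT.measurable hsm.compl)]
    refine Eventually.of_forall fun t => ?_
    exact (hT.measurePreserving t).quasiMeasurePreserving.ae
      (p := fun x => x ∉ s) (measure_eq_zero_iff_ae_notMem.1 hμ)
  filter_upwards [h] with x hx
  filter_upwards [hx] with r hr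
  by_contra hc
  exact hr (hs hc)

theorem lintegral_orbit [SFinite μ] (hT : IsMeasurableFlow T μ) {g : X → ℝ≥0∞}
    (hg : Measurable g) (S : Set ℝ) :
    ∫⁻ x, (∫⁻ r in S, g (T r x)) ∂μ = volume S * ∫⁻ x, g x ∂μ := by
  rw [lintegral_lintegral_swap]
  · simp_rw [fun r => (hT.measurePreserving r).lintegral_comp hg]
    rw [setLIntegral_const, mul_comm]
  · exact (hg.comp (hT.measurable.comp measurable_swap)).aemeasurable

theorem measurable_setLIntegral_orbit (hT : IsMeasurableFlow T μ) {g : X → ℝ≥0∞}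
    (hg : Measurable g) (S : Set ℝ) : Measurable fun x => ∫⁻ r in S, g (T r x) :=
  Measurable.lintegral_prod_right (hg.comp (hT.measurable.comp measurable_swap))

theorem ae_locallyIntegrable_orbit [SFinite μ] (hT : IsMeasurableFlow T μ) {f : X → ℝ}
    (hf : Integrable f μ) : ∀ᵐ x ∂μ, LocallyIntegrable fun r => f (T r x) := by
  have hg := hf.1.measurable_mk
  have hfin : ∀ n : ℕ, ∀ᵐ x ∂μ,
      ∫⁻ r in Set.Icc (-n : ℝ) n, ‖hf.1.mk f (T r x)‖ₑ < ∞ := by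
    intro n
    refine ae_lt_top (hT.measurable_setLIntegral_orbit hg.enorm _) ?_
    rw [hT.lintegral_orbit hg.enorm]
    refine ENNReal.mul_ne_top (by simp) ?_
    exact ((hf.congr hf.1.ae_eq_mk).2).ne
  filter_upwards [ae_all_iff.2 hfin, hT.ae_orbit hf.1.ae_eq_mk] with x hx hxe
  refine LocallyIntegrable.congr ?_ (hxe.mono fun r hr => hr.symm)
  rw [locallyIntegrable_iff]
  intro k hk
  obtain ⟨R, hR⟩ := hk.isBounded.subset_closedBall 0
  obtain ⟨n, hn⟩ := exists_nat_ge R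
  have : IntegrableOn (fun r => hf.1.mk f (T r x)) (Set.Icc (-n : ℝ) n) :=
    ⟨(hT.measurable_comp_orbit hg x).aestronglyMeasurable, hx n⟩
  refine this.mono_set (hR.trans ?_)
  rw [Real.closedBall_eq_Icc]
  exact Set.Icc_subset_Icc (by linarith) (by linarith)

end IsMeasurableFlow

namespace HasSmallOrbitIntegrals

variable {X : Type*} [MeasurableSpace X] {T : ℝ → X → X} {μ : Measure X} {f g : X → ℝ}

theorem congr [SFinite μ] (hT : IsMeasurableFlow T μ) (hf : HasSmallOrbitIntegrals T μ f)
    (hfg : f =ᵐ[μ] g) : HasSmallOrbitIntegrals T μ g := by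
  intro ε hε
  obtain ⟨C, e, he, heε, h⟩ := hf ε hε
  refine ⟨C, e, he, heε, ?_⟩
  filter_upwards [h, hT.ae_orbit hfg] with x hx hxe s hs
  rw [← intervalIntegral.integral_congr_ae (hxe.mono fun r hr _ => hr)]
  exact hx s hs

theorem zero : HasSmallOrbitIntegrals T μ 0 := fun ε _ => ⟨0, 0, measurable_const, by simp, by simp⟩

theorem add [SFinite μ] (hT : IsMeasurableFlow T μ) (hf : HasSmallOrbitIntegrals T μ f)
    (hg : HasSmallOrbitIntegrals T μ g) (hfi : Integrable f μ) (hgi : Integrable g μ) :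
    HasSmallOrbitIntegrals T μ (f + g) := by
  intro ε hε
  obtain ⟨C, e, he, heε, h⟩ := hf (ε / 2) (ENNReal.half_pos hε.ne')
  obtain ⟨C', e', he', heε', h'⟩ := hg (ε / 2) (ENNReal.half_pos hε.ne')
  refine ⟨C + C', e + e', he.add he', ?_, ?_⟩
  · simp only [Pi.add_apply]
    rw [lintegral_add_left he]
    exact (add_le_add heε heε').trans (ENNReal.add_halves ε).le
  filter_upwards [h, h', hT.ae_locallyIntegrable_orbit hfi, hT.ae_locallyIntegrable_orbit hgi]
    with x hx hx' hfx hgx s hs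
  simp only [Pi.add_apply]
  rw [intervalIntegral.integral_add (hfx.integrableOn_isCompact isCompact_uIcc).intervalIntegrable
    (hgx.integrableOn_isCompact isCompact_uIcc).intervalIntegrable,
    lintegral_add_left (hT.measurable_comp_orbit he x), ENNReal.coe_add, add_add_add_comm]
  exact (enorm_add_le _ _).trans (add_le_add (hx s hs) (hx' s hs))

theorem const_smul (c : ℝ) (hT : IsMeasurableFlow T μ) (hf : HasSmallOrbitIntegrals T μ f) :
    HasSmallOrbitIntegrals T μ (c • f) := by
  intro ε hε
  obtain ⟨C, e, he, heε, h⟩ := hf (ε / (‖c‖ₑ + 1)) (ENNReal.div_pos hε.ne' (by simp))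
  refine ⟨‖c‖₊ * C, fun x => ‖c‖ₑ * e x, he.const_mul _, ?_, ?_⟩
  · rw [lintegral_const_mul _ he]
    calc ‖c‖ₑ * ∫⁻ x, e x ∂μ ≤ (‖c‖ₑ + 1) * (ε / (‖c‖ₑ + 1)) := by gcongr; exact le_self_add
      _ ≤ ε := ENNReal.mul_div_le
  filter_upwards [h] with x hx s hs
  simp only [Pi.smul_apply]
  rw [intervalIntegral.integral_smul, enorm_smul,
    lintegral_const_mul _ (hT.measurable_comp_orbit he x), ENNReal.coe_mul]
  refine (mul_le_mul_right (hx s hs) _).trans_eq ?_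
  rw [mul_add]; rfl

theorem of_enorm_le [SFinite μ] (hT : IsMeasurableFlow T μ) (hfi : Integrable f μ)
    (h : ∀ ε : ℝ≥0∞, 0 < ε → ∃ g, Integrable g μ ∧ HasSmallOrbitIntegrals T μ g ∧
      ∫⁻ x, ‖f x - g x‖ₑ ∂μ ≤ ε) : HasSmallOrbitIntegrals T μ f := by
  intro ε hε
  obtain ⟨g, hgi, hg, hgε⟩ := h (ε / 2) (ENNReal.half_pos hε.ne')
  obtain ⟨C, e, he, heε, h⟩ := hg (ε / 2) (ENNReal.half_pos hε.ne')
  have hd : AEMeasurable (fun x => ‖f x - g x‖ₑ) μ := (hfi.sub hgi).1.enorm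
  refine ⟨C, e + hd.mk _, he.add hd.measurable_mk, ?_, ?_⟩
  · simp only [Pi.add_apply]
    rw [lintegral_add_left he, ← lintegral_congr_ae hd.ae_eq_mk]
    exact (add_le_add heε hgε).trans (ENNReal.add_halves ε).le
  filter_upwards [h, hT.ae_locallyIntegrable_orbit hfi, hT.ae_locallyIntegrable_orbit hgi,
    hT.ae_orbit hd.ae_eq_mk] with x hx hfx hgx hdx s hs
  simp only [Pi.add_apply]
  have hsub := intervalIntegral.integral_sub (a := 0) (b := s) (μ := volume)
    (hfx.integrableOn_isCompact isCompact_uIcc).intervalIntegrable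
    (hgx.integrableOn_isCompact isCompact_uIcc).intervalIntegrable
  rw [lintegral_add_left (hT.measurable_comp_orbit he x), ← add_assoc,
    ← sub_add_cancel (∫ r in (0:ℝ)..s, f (T r x)) (∫ r in (0:ℝ)..s, g (T r x)), ← hsub, add_comm]
  refine (enorm_add_le _ _).trans (add_le_add (hx s hs) ?_)
  rw [← lintegral_congr_ae (ae_restrict_of_ae hdx), intervalIntegral.integral_of_le hs]
  exact enorm_integral_le_lintegral_enorm _

theorem coboundary (hT : IsMeasurableFlow T μ) (hfm : Measurable f) {c : ℝ}
    (hfc : ∀ x, |f x| ≤ c) (a : ℝ) :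
    HasSmallOrbitIntegrals T μ (f - f ∘ T a) := by
  intro ε hε
  refine ⟨(2 * c * |a|).toNNReal, 0, measurable_const, by simp, Eventually.of_forall fun x s hs => ?_⟩
  have hi : ∀ u v : ℝ, IntervalIntegrable (fun r => f (T r x)) volume u v := fun u v => by
    refine (intervalIntegrable_const (c := c)).mono_fun
      (hT.measurable_comp_orbit hfm x).aestronglyMeasurable (Eventually.of_forall fun r => ?_)
    exact (hfc _).trans (le_abs_self c)
  have hb : ∀ u, ‖∫ r in u..(u + a), f (T r x)‖ ≤ c * |a| := fun u => by
    simpa using intervalIntegral.norm_integral_le_of_norm_le_const (a := u) (b := u + a)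
      (f := fun r => f (T r x)) (C := c) fun r _ => hfc _
  have heq : ∫ r in (0:ℝ)..s, (f - f ∘ T a) (T r x) =
      (∫ r in (0:ℝ)..a, f (T r x)) - ∫ r in s..(s + a), f (T r x) := by
    have hi' : IntervalIntegrable (fun r => f (T (r + a) x)) volume 0 s := by
      simpa using (hi (0 + a) (s + a)).comp_add_right a
    have : ∀ r, (f - f ∘ T a) (T r x) = f (T r x) - f (T (r + a) x) := fun r => by
      simp [add_comm r a, hT.apply_add]
    simp_rw [this]
    rw [intervalIntegral.integral_sub (hi _ _) hi',
      intervalIntegral.integral_comp_add_right (fun r => f (T r x)), zero_add,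
      intervalIntegral.integral_interval_sub_interval_comm (hi _ _) (hi _ _) (hi _ _)]
  rw [heq]
  simp only [Pi.zero_apply, lintegral_zero, add_zero]
  rw [← ofReal_norm]
  refine ENNReal.ofReal_le_ofReal ((norm_sub_le _ _).trans ?_)
  have h0 := hb 0
  rw [zero_add] at h0
  linarith [hb s]

end HasSmallOrbitIntegrals

namespace IsMeasurableFlow

variable {X : Type*} [MeasurableSpace X] {T : ℝ → X → X} {μ : Measure X}

/-- The closed subspace of `L²` functions with small orbit integrals. -/
def smallL2 [IsFiniteMeasure μ] (hT : IsMeasurableFlow T μ) : Submodule ℝ (Lp ℝ 2 μ) where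
  carrier := {g | HasSmallOrbitIntegrals T μ g}
  zero_mem' := HasSmallOrbitIntegrals.zero.congr hT (Lp.coeFn_zero ℝ 2 μ).symm
  add_mem' {f g} hf hg := (hf.add hT hg ((Lp.memLp f).integrable one_le_two)
    ((Lp.memLp g).integrable one_le_two)).congr hT (Lp.coeFn_add f g).symm
  smul_mem' c f hf := (hf.const_smul c hT).congr hT (Lp.coeFn_smul c f).symm

theorem isClosed_smallL2 [IsProbabilityMeasure μ] (hT : IsMeasurableFlow T μ) :
    IsClosed (hT.smallL2 : Set (Lp ℝ 2 μ)) := by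
  refine isClosed_of_closure_subset fun f hf => ?_
  refine HasSmallOrbitIntegrals.of_enorm_le hT ((Lp.memLp f).integrable one_le_two) fun ε hε => ?_
  obtain ⟨g, hg, hfg⟩ := EMetric.mem_closure_iff.1 hf ε hε
  refine ⟨g, (Lp.memLp g).integrable one_le_two, hg, ?_⟩
  rw [Lp.edist_def] at hfg
  refine le_trans ?_ hfg.le
  have := eLpNorm_le_eLpNorm_of_exponent_le (p := 1) (q := 2) (μ := μ) one_le_two
    ((Lp.memLp f).1.sub (Lp.memLp g).1)
  rwa [eLpNorm_one_eq_lintegral_enorm] at this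

theorem coboundary_mem_smallL2 [IsProbabilityMeasure μ] (hT : IsMeasurableFlow T μ) (a : ℝ)
    (h : Lp ℝ 2 μ) :
    h - Lp.compMeasurePreservingₗᵢ ℝ (T a) (hT.measurePreserving a) h ∈ hT.smallL2 := by
  set U := Lp.compMeasurePreservingₗᵢ (E := ℝ) (p := 2) ℝ (T a) (hT.measurePreserving a)
  induction h using Lp.induction (ENNReal.ofNat_ne_top (n := 2)) with
  | indicatorConst c hs hμs =>
    rename_i s
    have hm : Measurable (s.indicator fun _ => c) := measurable_const.indicator hs
    have hco := HasSmallOrbitIntegrals.coboundary hT hm (c := |c|)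
      (fun x => by by_cases hx : x ∈ s <;> simp [hx]) a
    refine hco.congr hT ?_
    have h1 : (indicatorConstLp 2 hs hμs.ne c : X → ℝ) =ᵐ[μ] s.indicator fun _ => c :=
      indicatorConstLp_coeFn
    rw [Lp.simpleFunc.coe_indicatorConst]
    filter_upwards [Lp.coeFn_sub (indicatorConstLp 2 hs hμs.ne c)
      (U (indicatorConstLp 2 hs hμs.ne c)), h1,
      Lp.coeFn_compMeasurePreserving (indicatorConstLp 2 hs hμs.ne c) (hT.measurePreserving a),
      (hT.measurePreserving a).quasiMeasurePreserving.ae h1] with x e1 e2 e3 e4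
    rw [e1, Pi.sub_apply, Pi.sub_apply, e2]
    congr 1
    exact (e3.trans e4).symm
  | add hf hg _ h1 h2 =>
    rw [map_add, add_sub_add_comm]
    exact add_mem h1 h2
  | isClosed =>
    exact hT.isClosed_smallL2.preimage (continuous_id.sub U.continuous)

theorem ae_eq_const_of_mem_orthogonal [IsProbabilityMeasure μ] (hT : IsMeasurableFlow T μ)
    (hTerg : ∀ E : Set X, MeasurableSet E → (∀ t : ℝ, T t ⁻¹' E =ᵐ[μ] E) → μ E = 0 ∨ μ E = 1)
    {g : Lp ℝ 2 μ} (hg : g ∈ hT.smallL2ᗮ) : ∃ c, g =ᵐ[μ] Function.const X c := by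
  have hinv : ∀ a, g ∘ T a =ᵐ[μ] g := by
    intro a
    set U := Lp.compMeasurePreservingₗᵢ (E := ℝ) (p := 2) ℝ (T a) (hT.measurePreserving a)
    have h0 : inner ℝ (g - U g) g = 0 :=
      (Submodule.mem_orthogonal _ _).1 hg _ (hT.coboundary_mem_smallL2 a g)
    have h1 : ‖U g‖ = ‖g‖ := U.norm_map g
    have h2 : U g = g := by
      rw [inner_sub_left, real_inner_self_eq_norm_sq] at h0
      have h3 := norm_sub_sq_real (U g) g
      rw [h1] at h3
      have h4 : ‖U g - g‖ ^ 2 = 0 := by linarith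
      exact sub_eq_zero.1 (norm_eq_zero.1 (pow_eq_zero_iff two_ne_zero |>.1 h4))
    have h5 := Lp.coeFn_compMeasurePreserving g (hT.measurePreserving a)
    exact h5.symm.trans (Eventually.of_forall fun x => congrArg (fun k : Lp ℝ 2 μ => k x) h2)
  have hm := (Lp.stronglyMeasurable g).measurable
  refine exists_eventuallyEq_const_of_forall_separating MeasurableSet fun V hV => ?_
  rcases hTerg (g ⁻¹' V) (hm hV) fun t => (hinv t).mono fun x hx => by
    exact congrArg (· ∈ V) hx with h | h
  · exact Or.inr (measure_eq_zero_iff_ae_notMem.1 h)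
  · exact Or.inl ((prob_compl_eq_zero_iff (hm hV)).2 h)

/-- Mean-zero integrable functions on an ergodic flow are `L¹`-limits of coboundaries, hence
have small orbit integrals. -/
theorem hasSmallOrbitIntegrals [IsProbabilityMeasure μ] (hT : IsMeasurableFlow T μ)
    (hTerg : ∀ E : Set X, MeasurableSet E → (∀ t : ℝ, T t ⁻¹' E =ᵐ[μ] E) → μ E = 0 ∨ μ E = 1)
    {f : X → ℝ} (hf : Integrable f μ) (hf0 : ∫ x, f x ∂μ = 0) :
    HasSmallOrbitIntegrals T μ f := by
  have hL2 : ∀ g : Lp ℝ 2 μ, ∫ x, g x ∂μ = 0 → HasSmallOrbitIntegrals T μ g := by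
    intro g hg
    change g ∈ hT.smallL2
    rw [← hT.isClosed_smallL2.submodule_topologicalClosure_eq,
      ← Submodule.orthogonal_orthogonal_eq_closure, Submodule.mem_orthogonal]
    intro u hu
    obtain ⟨c, hc⟩ := hT.ae_eq_const_of_mem_orthogonal hTerg hu
    rw [L2.inner_def]
    calc ∫ x, inner ℝ (u x) (g x) ∂μ = ∫ x, c * g x ∂μ :=
          integral_congr_ae (hc.mono fun x hx => by simp [hx, mul_comm])
      _ = 0 := by rw [integral_const_mul, hg, mul_zero]
  refine HasSmallOrbitIntegrals.of_enorm_le hT hf fun ε hε => ?_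
  obtain ⟨φ, hφ, hφm⟩ := (memLp_one_iff_integrable.2 hf).exists_simpleFunc_eLpNorm_sub_lt
    (by simp) (ENNReal.half_pos hε.ne').ne'
  have hφi := memLp_one_iff_integrable.1 hφm
  set m := ∫ x, φ x ∂μ
  have hm : ‖m‖ₑ ≤ ε / 2 := by
    have : m = -∫ x, (f x - φ x) ∂μ := by rw [integral_sub hf hφi, hf0]; simp [m]
    rw [this, enorm_neg]
    refine (enorm_integral_le_lintegral_enorm _).trans ?_
    rw [eLpNorm_one_eq_lintegral_enorm] at hφ
    exact hφ.le
  have hmem : MemLp (fun x => φ x - m) 2 μ := (φ.memLp_of_isFiniteMeasure 2 μ).sub (memLp_const m)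
  have hgi : Integrable (fun x => φ x - m) μ := hφi.sub (integrable_const m)
  refine ⟨fun x => φ x - m, hgi, (hL2 (hmem.toLp _) ?_).congr hT hmem.coeFn_toLp, ?_⟩
  · rw [integral_congr_ae hmem.coeFn_toLp, integral_sub hφi (integrable_const m)]
    simp [m]
  · calc ∫⁻ x, ‖f x - (φ x - m)‖ₑ ∂μ ≤ ∫⁻ x, (‖f x - φ x‖ₑ + ‖m‖ₑ) ∂μ := by
          refine lintegral_mono fun x => ?_
          rw [← sub_add]
          exact enorm_add_le _ _
      _ = ∫⁻ x, ‖f x - φ x‖ₑ ∂μ + ‖m‖ₑ := by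
          rw [lintegral_add_right _ measurable_const]; simp
      _ ≤ ε / 2 + ε / 2 := by
          rw [eLpNorm_one_eq_lintegral_enorm] at hφ
          exact add_le_add hφ.le hm
      _ = ε := ENNReal.add_halves ε

end IsMeasurableFlow

/-- A map of the line that expands distances on `S` by a factor `c` expands the measure of `S`. -/
theorem mul_volume_le_volume_image {F : ℝ → ℝ} {S : Set ℝ} {c : ℝ≥0} (hc : c ≠ 0)
    (hF : ∀ s ∈ S, ∀ t ∈ S, c * dist s t ≤ dist (F s) (F t)) :
    c * volume S ≤ volume (F '' S) := by
  have hinj : Set.InjOn F S := fun s hs t ht hst => by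
    have h := hF s hs t ht
    rw [hst, dist_self] at h
    have hc' : (0:ℝ) < c := NNReal.coe_pos.2 (pos_iff_ne_zero.2 hc)
    exact dist_le_zero.1 (nonpos_of_mul_nonpos_right h hc')
  have hlip : LipschitzOnWith c⁻¹ (Function.invFunOn F S) (F '' S) := by
    refine LipschitzOnWith.of_dist_le_mul ?_
    rintro _ ⟨s, hs, rfl⟩ _ ⟨t, ht, rfl⟩
    rw [hinj.leftInvOn_invFunOn hs, hinj.leftInvOn_invFunOn ht, NNReal.coe_inv]
    rw [le_inv_mul_iff₀ (NNReal.coe_pos.2 (pos_iff_ne_zero.2 hc))]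
    exact hF s hs t ht
  have h := hlip.hausdorffMeasure_image_le zero_le_one
  rw [hinj.leftInvOn_invFunOn.image_image, hausdorffMeasure_real, ENNReal.rpow_one,
    ENNReal.coe_inv hc] at h
  calc c * volume S ≤ c * ((c : ℝ≥0∞)⁻¹ * volume (F '' S)) := by gcongr
    _ = volume (F '' S) := by
      rw [← mul_assoc, ENNReal.mul_inv_cancel (by simpa using hc) ENNReal.coe_ne_top, one_mul]

theorem exists_linear_lower_bound_of_hasDerivAt {F : ℝ → ℝ} {d x : ℝ} (hF : HasDerivAt F d x)
    (hd : 0 < d) :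
    ∃ n : ℕ, ∀ q : ℝ, 0 < q → q < 1 / (n + 1) → 1 / (n + 1) * q ≤ F (x + q) - F x := by
  have h := (hasDerivAt_iff_tendsto_slope_zero.1 hF).eventually (lt_mem_nhds (half_lt_self hd))
  rw [eventually_nhdsWithin_iff, Metric.eventually_nhds_iff] at h
  obtain ⟨δ, hδ, h⟩ := h
  obtain ⟨n, hn⟩ := exists_nat_one_div_lt (lt_min hδ (half_pos hd))
  refine ⟨n, fun q hq hqn => ?_⟩
  have hq' := h (y := q) (by
    rw [Real.dist_0_eq_abs, abs_of_pos hq]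
    exact hqn.trans (hn.trans_le (min_le_left _ _))) hq.ne'
  rw [smul_eq_mul, lt_inv_mul_iff₀ hq] at hq'
  have := hn.trans_le (min_le_right _ _)
  nlinarith

namespace IsMeasurableFlow

variable {X : Type*} [MeasurableSpace X] {T : ℝ → X → X} {μ : Measure X} {f : X → ℝ}

theorem integral_orbit_shift (hT : IsMeasurableFlow T μ) (f : X → ℝ) (s q : ℝ) (x : X) :
    ∫ r in (0:ℝ)..q, f (T r (T s x)) = ∫ r in s..(s + q), f (T r x) := by
  simp_rw [← hT.apply_add]
  rw [intervalIntegral.integral_comp_add_right (fun r => f (T r x)), zero_add, add_comm]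

theorem integral_orbit_shift_eq_sub (hT : IsMeasurableFlow T μ) {x : X}
    (hx : LocallyIntegrable fun r => f (T r x)) (s q : ℝ) :
    ∫ r in (0:ℝ)..q, f (T r (T s x)) =
      (∫ r in (0:ℝ)..(s + q), f (T r x)) - ∫ r in (0:ℝ)..s, f (T r x) := by
  have hi : ∀ u v : ℝ, IntervalIntegrable (fun r => f (T r x)) volume u v := fun u v =>
    (hx.integrableOn_isCompact isCompact_uIcc).intervalIntegrable
  rw [hT.integral_orbit_shift, intervalIntegral.integral_interval_sub_left (hi _ _) (hi _ _)]

theorem exists_linear_growth [IsProbabilityMeasure μ] (hT : IsMeasurableFlow T μ)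
    (hfm : Measurable f) (hf : Integrable f μ) {A : Set X} (hA : MeasurableSet A)
    (hApos : 0 < μ A) (hAf : ∀ x ∈ A, 0 < f x)
    (hAi : ∀ x ∈ A, LocallyIntegrable fun r => f (T r x)) :
    ∃ B ⊆ A, MeasurableSet B ∧ 0 < μ B ∧ ∃ c : ℝ, 0 < c ∧
      ∀ x ∈ B, ∀ q ∈ Set.Ioo 0 c, c * q ≤ ∫ r in (0:ℝ)..q, f (T r x) := by
  have hΦ : ∀ q : ℝ, Measurable fun x => ∫ r in (0:ℝ)..q, f (T r x) := fun q => by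
    have h : StronglyMeasurable fun p : X × ℝ => f (T p.2 p.1) :=
      (hfm.comp (hT.measurable.comp measurable_swap)).stronglyMeasurable
    simp only [intervalIntegral]
    exact (h.integral_prod_right.measurable).sub (h.integral_prod_right.measurable)
  let B : ℕ → Set X := fun n => A ∩ ⋂ q : ℚ, {x | (0:ℝ) < q → (q:ℝ) < 1 / (n + 1) →
    1 / (n + 1) * (q:ℝ) ≤ ∫ r in (0:ℝ)..q, f (T r x)}
  have hB : ∀ n, MeasurableSet (B n) := fun n => hA.inter <| MeasurableSet.iInter fun q =>
    (MeasurableSet.const _).imp <| (MeasurableSet.const _).imp <|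
      measurableSet_le measurable_const (hΦ q)
  have hpos : ∃ n, 0 < μ (B n) := by
    by_contra! hnull
    have hae : ∀ᵐ x ∂μ, ∀ n, x ∉ B n := ae_all_iff.2 fun n =>
      measure_eq_zero_iff_ae_notMem.1 (nonpos_iff_eq_zero.1 (hnull n))
    have hA0 : ∀ᵐ x ∂μ, ∀ᵐ r : ℝ, T r x ∉ A := by
      filter_upwards [hT.ae_orbit hae, hT.ae_locallyIntegrable_orbit hf] with x hx hxi
      filter_upwards [hx, LocallyIntegrable.ae_hasDerivAt_integral hxi] with r hr hrd hrA
      obtain ⟨n, hn⟩ := exists_linear_lower_bound_of_hasDerivAt (hrd 0) (hAf _ hrA)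
      refine hr n ⟨hrA, Set.mem_iInter.2 fun q hq hqn => ?_⟩
      rw [hT.integral_orbit_shift_eq_sub hxi]
      exact hn q hq hqn
    have h := hT.lintegral_orbit (g := A.indicator 1) (measurable_one.indicator hA) (Set.Ioc 0 1)
    rw [lintegral_indicator_one hA, lintegral_congr_ae (g := 0), Pi.zero_def, lintegral_zero] at h
    · simp at h
      exact hApos.ne h
    · filter_upwards [hA0] with x hx
      rw [lintegral_congr_ae (g := 0) (ae_restrict_of_ae (hx.mono fun r hr => by simp [hr]))]
      simp
  obtain ⟨n, hn⟩ := hpos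
  refine ⟨B n, Set.inter_subset_left, hB n, hn, 1 / (n + 1), by positivity, fun x hx => ?_⟩
  have hi : ∀ u v : ℝ, IntervalIntegrable (fun r => f (T r x)) volume u v := fun u v =>
    ((hAi x hx.1).integrableOn_isCompact isCompact_uIcc).intervalIntegrable
  have hcl : IsClosed {q : ℝ | 1 / ((n:ℝ) + 1) * q ≤ ∫ r in (0:ℝ)..q, f (T r x)} :=
    isClosed_le (by fun_prop) (intervalIntegral.continuous_primitive hi 0)
  refine (Rat.denseRange_cast.open_subset_closure_inter isOpen_Ioo).trans
    (hcl.closure_subset_iff.2 ?_)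
  rintro _ ⟨hq, q, rfl⟩
  exact Set.mem_iInter.1 hx.2 q hq.1 hq.2

/-- A point of `A` whose orbit returns to `A` after a time larger than `N` with a vanishing
orbit integral. -/
theorem exists_return_integral_eq_zero_of_pos [IsProbabilityMeasure μ]
    (hT : IsMeasurableFlow T μ)
    (hfm : Measurable f) (hf : Integrable f μ) (hsmall : HasSmallOrbitIntegrals T μ f)
    {A : Set X} (hA : MeasurableSet A)
    (hApos : 0 < μ A) (hAf : ∀ x ∈ A, 0 < f x)
    (hAi : ∀ x ∈ A, LocallyIntegrable fun r => f (T r x)) (N : ℕ) :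
    ∃ x ∈ A, ∃ t : ℝ, N < t ∧ ∫ r in (0:ℝ)..t, f (T r x) = 0 ∧ T t x ∈ A := by
  by_contra! hno
  obtain ⟨B, hBA, hB, hBpos, c, hc, hgrow⟩ := hT.exists_linear_growth hfm hf hA hApos hAf hAi
  set M : ℝ := N + 1 with hM
  have hMpos : 0 < M := by positivity
  set η : ℝ := min c 1
  have hη : 0 < η := lt_min hc one_pos
  have hη1 : η ≤ 1 := min_le_right _ _
  have hηc : η ≤ c := min_le_left _ _
  let I : ℕ → Set ℝ := fun k => Set.Ico (k * M) (k * M + η)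
  set b : ℝ := (μ B).toReal
  have hb : 0 < b := ENNReal.toReal_pos hBpos.ne' (measure_ne_top _ _)
  have hβ : 0 < c * (η * b) := by positivity
  obtain ⟨C, e, he, heε, hbd⟩ := hsmall (ENNReal.ofReal (c * (η * b) / (4 * M)))
    (ENNReal.ofReal_pos.2 (by positivity))
  have hpt : ∀ K : ℕ, ∀ᵐ x ∂μ,
      ∑ k ∈ Finset.range K, ENNReal.ofReal c * ∫⁻ r in I k, B.indicator 1 (T r x) ≤
        2 * (C + ∫⁻ r in Set.Ioc 0 (K * M), e (T r x)) := by
    intro K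
    filter_upwards [hbd, hT.ae_locallyIntegrable_orbit hf] with x hx hxi
    set F : ℝ → ℝ := fun s => ∫ r in (0:ℝ)..s, f (T r x)
    have hFc : Continuous F := intervalIntegral.continuous_primitive
      (fun u v => (hxi.integrableOn_isCompact isCompact_uIcc).intervalIntegrable) 0
    have hBx : MeasurableSet {r | T r x ∈ B} := hT.measurable_orbit x hB
    let S : ℕ → Set ℝ := fun k => {r | T r x ∈ B} ∩ I k
    have hS : ∀ k, MeasurableSet (S k) := fun k => hBx.inter measurableSet_Ico
    have hexp' : ∀ k, ∀ s ∈ S k, ∀ t ∈ S k, s ≤ t → c * (t - s) ≤ F t - F s := by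
      intro k s hs t ht hst
      rcases hst.eq_or_lt with rfl | hst
      · simp
      have h := hgrow _ hs.1 (t - s) ⟨sub_pos.2 hst, by linarith [hs.2.1, ht.2.2]⟩
      rwa [hT.integral_orbit_shift_eq_sub hxi, add_sub_cancel] at h
    have hexp : ∀ k, ∀ s ∈ S k, ∀ t ∈ S k, c.toNNReal * dist s t ≤ dist (F s) (F t) := by
      intro k s hs t ht
      rw [Real.coe_toNNReal c hc.le]
      rcases le_total s t with hst | hst
      · rw [dist_comm s t, dist_comm (F s), Real.dist_eq, abs_of_nonneg (sub_nonneg.2 hst)]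
        exact (hexp' k s hs t ht hst).trans (le_abs_self _)
      · rw [Real.dist_eq, abs_of_nonneg (sub_nonneg.2 hst)]
        exact (hexp' k t ht s hs hst).trans (le_abs_self _)
    have hc0 : c.toNNReal ≠ 0 := (Real.toNNReal_pos.2 hc).ne'
    have hinj : ∀ k, Set.InjOn F (S k) := fun k s hs t ht hst => by
      have h := hexp k s hs t ht
      rw [hst, dist_self] at h
      exact dist_le_zero.1 (nonpos_of_mul_nonpos_right h (NNReal.coe_pos.2 (pos_iff_ne_zero.2 hc0)))
    have hdisj' : ∀ j k, j < k → Disjoint (F '' S j) (F '' S k) := by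
      intro j k hjk
      rw [Set.disjoint_left]
      rintro _ ⟨s, hs, rfl⟩ ⟨t, ht, hts⟩
      have hjk' : (j:ℝ) + 1 ≤ k := by exact_mod_cast hjk
      have hlt : (N:ℝ) < t - s := by
        have h1 := hs.2.2
        have h2 := ht.2.1
        nlinarith
      refine hno (T s x) (hBA hs.1) (t - s) hlt ?_ ?_
      · rw [hT.integral_orbit_shift_eq_sub hxi, add_sub_cancel, sub_eq_zero]
        exact hts
      · rw [← hT.apply_add, sub_add_cancel]
        exact hBA ht.1
    have hdisj : Pairwise (Function.onFun Disjoint fun k => F '' S k) := fun j k hjk =>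
      hjk.lt_or_gt.elim (hdisj' j k) fun h => (hdisj' k j h).symm
    calc ∑ k ∈ Finset.range K, ENNReal.ofReal c * ∫⁻ r in I k, B.indicator 1 (T r x)
        = ∑ k ∈ Finset.range K, (c.toNNReal : ℝ≥0∞) * volume (S k) := by
          refine Finset.sum_congr rfl fun k _ => ?_
          have : (fun r => B.indicator (1 : X → ℝ≥0∞) (T r x)) =
              {r | T r x ∈ B}.indicator 1 := by
            ext r; by_cases h : T r x ∈ B <;> simp [h]
          rw [this, lintegral_indicator_one hBx, Measure.restrict_apply hBx]
          rfl
      _ ≤ ∑ k ∈ Finset.range K, volume (F '' S k) :=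
          Finset.sum_le_sum fun k _ => mul_volume_le_volume_image hc0 (hexp k)
      _ = volume (⋃ k ∈ Finset.range K, F '' S k) :=
          (measure_biUnion_finset (fun j _ k _ hjk => hdisj hjk) fun k _ =>
            (hS k).image_of_continuousOn_injOn hFc.continuousOn (hinj k)).symm
      _ ≤ volume (Metric.closedEBall (0:ℝ) (C + ∫⁻ r in Set.Ioc 0 (K * M), e (T r x))) := by
          refine measure_mono (Set.iUnion₂_subset fun k hk => ?_)
          rintro _ ⟨s, hs, rfl⟩
          have hk' : (k:ℝ) + 1 ≤ K := by exact_mod_cast Finset.mem_range.1 hk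
          have h0 : 0 ≤ s := le_trans (by positivity) hs.2.1
          have h1 : s ≤ K * M := by
            have h2 := hs.2.2
            nlinarith
          rw [Metric.mem_closedEBall, edist_zero_right]
          refine (hx s h0).trans ?_
          gcongr
      _ = 2 * (C + ∫⁻ r in Set.Ioc 0 (K * M), e (T r x)) := Real.volume_closedEBall _ _
  have hint : ∀ K : ℕ, K * (c * (η * b)) ≤ 2 * (C + K * (c * (η * b)) / 4) := by
    intro K
    have hBm : Measurable (B.indicator (1 : X → ℝ≥0∞)) := measurable_one.indicator hB
    have h := lintegral_mono_ae (hpt K)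
    rw [lintegral_finsetSum _ fun k _ => (hT.measurable_setLIntegral_orbit hBm _).const_mul _,
      lintegral_const_mul _ ((hT.measurable_setLIntegral_orbit he _).const_add _),
      lintegral_add_left measurable_const, hT.lintegral_orbit he] at h
    have hk : ∀ k, ∫⁻ x, (ENNReal.ofReal c * ∫⁻ r in I k, B.indicator 1 (T r x)) ∂μ =
        ENNReal.ofReal c * (ENNReal.ofReal η * μ B) := fun k => by
      rw [lintegral_const_mul _ (hT.measurable_setLIntegral_orbit hBm _), hT.lintegral_orbit hBm,
        lintegral_indicator_one hB, Real.volume_Ico, add_sub_cancel_left]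
    simp_rw [hk, Real.volume_Ioc] at h
    simp only [Finset.sum_const, Finset.card_range, lintegral_const,
      measure_univ, mul_one, sub_zero, nsmul_eq_mul] at h
    have h' := h.trans (mul_le_mul_right (add_le_add_right (mul_le_mul_right heε _) _) _)
    rw [← ENNReal.ofReal_toReal (measure_ne_top μ B), ← ENNReal.ofReal_mul hη.le,
      ← ENNReal.ofReal_mul hc.le, ← ENNReal.ofReal_natCast, ← ENNReal.ofReal_mul (by positivity),
      ← ENNReal.ofReal_mul (by positivity), ← ENNReal.ofReal_coe_nnreal,
      ← ENNReal.ofReal_add (by positivity) (by positivity),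
      ← ENNReal.ofReal_ofNat 2, ← ENNReal.ofReal_mul (by positivity),
      ENNReal.ofReal_le_ofReal_iff (by positivity)] at h'
    refine h'.trans_eq ?_
    field_simp
  obtain ⟨K, hK⟩ := exists_nat_gt (4 * C / (c * (η * b)))
  rw [div_lt_iff₀ hβ] at hK
  linarith [hint K]

end IsMeasurableFlow

/-- Key step in the proof of Theorem 2: for every measurable `A ⊆ {f ≠ 0}` of positive
measure and every `N : ℕ` there exist `x`, `t₁ ≥ 0`, `t > N` such that
`Φ(t₁, x) = Φ(t₁ + t, x)` and `T_{t₁} x, T_{t₁+t} x ∈ A`. -/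
theorem exists_equal_integrals_in_A
    {X : Type*} [MeasurableSpace X] (μ : Measure X) [IsProbabilityMeasure μ]
    (T : ℝ → X → X)
    (hT0 : T 0 = id)
    (hTadd : ∀ s t : ℝ, T (s + t) = T s ∘ T t)
    (hTmp : ∀ t : ℝ, MeasurePreserving (T t) μ μ)
    (hTmeas : Measurable fun p : ℝ × X => T p.1 p.2)
    (hTerg : ∀ E : Set X, MeasurableSet E → (∀ t : ℝ, T t ⁻¹' E =ᵐ[μ] E) →
      μ E = 0 ∨ μ E = 1)
    (f : X → ℝ) (hf : Integrable f μ) (hf0 : ∫ x, f x ∂μ = 0)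
    (A : Set X) (hA : MeasurableSet A) (hAsub : A ⊆ {x : X | f x ≠ 0})
    (hApos : 0 < μ A) (N : ℕ) :
    ∃ (x : X) (t₁ t : ℝ), 0 ≤ t₁ ∧ (N : ℝ) < t ∧
      (∫ s in (0:ℝ)..t₁, f (T s x)) = ∫ s in (0:ℝ)..(t₁ + t), f (T s x) ∧
      T t₁ x ∈ A ∧ T (t₁ + t) x ∈ A := by
  have hT : IsMeasurableFlow T μ := ⟨hT0, hTadd, hTmp, hTmeas⟩
  suffices h : ∃ x ∈ A, ∃ t : ℝ, N < t ∧ ∫ r in (0:ℝ)..t, f (T r x) = 0 ∧ T t x ∈ A by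
    obtain ⟨x, hx, t, ht, hint, hxt⟩ := h
    exact ⟨x, 0, t, le_rfl, ht, by simp [hint], by rwa [hT.apply_zero], by rwa [zero_add]⟩
  have hsmall := hT.hasSmallOrbitIntegrals hTerg hf hf0
  obtain ⟨g, hgm, hfg⟩ : ∃ g, Measurable g ∧ f =ᵐ[μ] g :=
    ⟨_, hf.1.measurable_mk, hf.1.ae_eq_mk⟩
  have hgi := hf.congr hfg
  obtain ⟨Z, hZsub, hZ, hZ0⟩ := exists_measurable_superset_of_null (ae_iff.1
    (hfg.and ((hT.ae_orbit hfg).and (hT.ae_locallyIntegrable_orbit hgi))))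
  have hgood : ∀ x ∈ A \ Z, f x = g x ∧ (∀ᵐ r : ℝ, f (T r x) = g (T r x)) ∧
      LocallyIntegrable fun r => g (T r x) := fun x hx => by
    by_contra hc
    exact hx.2 (hZsub hc)
  have hintegral : ∀ x ∈ A \ Z, ∀ t : ℝ,
      ∫ r in (0:ℝ)..t, f (T r x) = ∫ r in (0:ℝ)..t, g (T r x) := fun x hx t =>
    intervalIntegral.integral_congr_ae ((hgood x hx).2.1.mono fun r hr _ => hr)
  have hAZ : 0 < μ (A \ Z) := by rwa [measure_sdiff_null hZ0]
  have hcover : A \ Z ⊆ (A \ Z) ∩ {x | 0 < g x} ∪ (A \ Z) ∩ {x | g x < 0} := fun x hx => by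
    have hne : g x ≠ 0 := (hgood x hx).1 ▸ hAsub hx.1
    exact hne.lt_or_gt.elim (fun h => Or.inr ⟨hx, h⟩) fun h => Or.inl ⟨hx, h⟩
  have hsmall' := hsmall.congr hT hfg
  by_cases hpos : 0 < μ ((A \ Z) ∩ {x | 0 < g x})
  · obtain ⟨x, hx, t, ht, hxt, hTx⟩ := hT.exists_return_integral_eq_zero_of_pos hgm hgi hsmall'
      ((hA.diff hZ).inter (measurableSet_lt measurable_const hgm)) hpos (fun x hx => hx.2)
      (fun x hx => (hgood x hx.1).2.2) N
    exact ⟨x, hx.1.1, t, ht, (hintegral x hx.1 t).trans hxt, hTx.1.1⟩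
  · have hneg : 0 < μ ((A \ Z) ∩ {x | g x < 0}) := by
      refine pos_iff_ne_zero.2 fun h => hAZ.ne' ?_
      exact measure_mono_null hcover (measure_union_null (nonpos_iff_eq_zero.1 (not_lt.1 hpos)) h)
    have hsmall_neg : HasSmallOrbitIntegrals T μ (-g) := by
      simpa using hsmall'.const_smul (-1) hT
    obtain ⟨x, hx, t, ht, hxt, hTx⟩ := hT.exists_return_integral_eq_zero_of_pos hgm.neg hgi.neg
      hsmall_neg ((hA.diff hZ).inter (measurableSet_lt hgm measurable_const)) hneg
      (fun x hx => neg_pos.2 hx.2) (fun x hx => (hgood x hx.1).2.2.neg) N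
    refine ⟨x, hx.1.1, t, ht, (hintegral x hx.1 t).trans ?_, hTx.1.1⟩
    simpa using hxt
end

section
/- Let b > 0, let f ∈ L¹([0,b]) with respect to Lebesgue measure m, and define F : [0,b] → ℝ by F(t) = ∫_0^t f(s) dm(s). Then for every measurable set D ⊆ [0,b], the Lebesgue (outer) measure of the image F(D) satisfies m(F(D)) ≤ ∫_D |f| dm. -/
open MeasureTheory intervalIntegral

/-- If the oscillation of `F` between two points of `D` is controlled by the `μ`-measure of the
interval joining them, then the outer measure of `F '' D` is at most the `μ`-measure of any open
set containing `D`. -/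
theorem volume_image_le_measure_of_isOpen {μ : Measure ℝ} {F : ℝ → ℝ} {D U : Set ℝ}
    (hF : ∀ x ∈ D, ∀ y ∈ D, edist (F x) (F y) ≤ μ (Set.uIcc x y))
    (hU : IsOpen U) (hDU : D ⊆ U) : volume (F '' D) ≤ μ U := by
  set T : Set (Set ℝ) := connectedComponentIn U '' U with hT
  have hopen : ∀ t ∈ T, IsOpen t := by
    rintro _ ⟨x, -, rfl⟩
    exact hU.connectedComponentIn
  have hdisj : T.PairwiseDisjoint id := by
    rintro _ ⟨x, -, rfl⟩ _ ⟨y, -, rfl⟩ hxy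
    refine Set.disjoint_left.2 fun z hzx hzy => hxy ?_
    exact (connectedComponentIn_eq hzx).trans (connectedComponentIn_eq hzy).symm
  have hcount : T.Countable := by
    refine hdisj.countable_of_isOpen hopen ?_
    rintro _ ⟨x, hx, rfl⟩
    exact ⟨x, mem_connectedComponentIn hx⟩
  have hcover : F '' D ⊆ ⋃ t ∈ T, F '' (t ∩ D) := by
    rintro _ ⟨x, hx, rfl⟩
    exact Set.mem_biUnion (Set.mem_image_of_mem _ (hDU hx))
      (Set.mem_image_of_mem F ⟨mem_connectedComponentIn (hDU hx), hx⟩)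
  have hpiece : ∀ t ∈ T, volume (F '' (t ∩ D)) ≤ μ t := by
    rintro _ ⟨x, -, rfl⟩
    refine (Real.volume_le_diam _).trans (Metric.ediam_le ?_)
    rintro _ ⟨y, ⟨hy, hyD⟩, rfl⟩ _ ⟨z, ⟨hz, hzD⟩, rfl⟩
    exact (hF y hyD z hzD).trans
      (measure_mono (isPreconnected_connectedComponentIn.ordConnected.uIcc_subset hy hz))
  have := hcount.to_subtype
  calc volume (F '' D) ≤ volume (⋃ t ∈ T, F '' (t ∩ D)) := measure_mono hcover
    _ ≤ ∑' t : T, volume (F '' (t ∩ D)) := measure_biUnion_le _ hcount _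
    _ ≤ ∑' t : T, μ t := ENNReal.tsum_le_tsum fun t => hpiece t t.2
    _ = μ (⋃₀ T) := (measure_sUnion hcount hdisj fun t ht => (hopen t ht).measurableSet).symm
    _ ≤ μ U := measure_mono <| Set.sUnion_subset <| by
        rintro _ ⟨x, -, rfl⟩
        exact connectedComponentIn_subset U x

/-- If the oscillation of `F` between two points of `D` is controlled by the `μ`-measure of the
interval joining them, with `μ` outer regular, then the outer measure of `F '' D` is at most
`μ D`. -/
theorem volume_image_le_measure {μ : Measure ℝ} [μ.OuterRegular] {F : ℝ → ℝ} {D : Set ℝ}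
    (hF : ∀ x ∈ D, ∀ y ∈ D, edist (F x) (F y) ≤ μ (Set.uIcc x y)) :
    volume (F '' D) ≤ μ D := by
  rw [D.measure_eq_iInf_isOpen μ]
  exact le_iInf₂ fun U hDU => le_iInf fun hU => volume_image_le_measure_of_isOpen hF hU hDU

/-- Lemma: if `f ∈ L¹[0,b]` and `F t = ∫_0^t f dm`, then for every measurable
`D ⊆ [0,b]` the Lebesgue outer measure of the image `F '' D` is at most `∫_D |f| dm`. -/
theorem measure_image_indefinite_integral_le
    (b : ℝ) (hb : 0 < b) (f : ℝ → ℝ)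
    (hf : IntegrableOn f (Set.Icc 0 b) volume)
    (F : ℝ → ℝ) (hF : ∀ t : ℝ, F t = ∫ s in (0:ℝ)..t, f s)
    (D : Set ℝ) (hD : MeasurableSet D) (hDsub : D ⊆ Set.Icc 0 b) :
    volume (F '' D) ≤ ENNReal.ofReal (∫ s in D, |f s|) := by
  set μ : Measure ℝ := (volume.restrict (Set.Icc 0 b)).withDensity fun s => ‖f s‖ₑ with hμ
  have : IsFiniteMeasure μ := isFiniteMeasure_withDensity hf.2.ne
  have hμ_apply : ∀ A, MeasurableSet A → A ⊆ Set.Icc 0 b → μ A = ∫⁻ s in A, ‖f s‖ₑ := by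
    intro A hA hAsub
    rw [hμ, withDensity_apply _ hA, Measure.restrict_restrict hA,
      Set.inter_eq_left.2 hAsub]
  have hint : ∀ x ∈ Set.Icc 0 b, ∀ y ∈ Set.Icc 0 b, IntervalIntegrable f volume x y :=
    fun x hx y hy => (hf.mono_set (Set.ordConnected_Icc.uIcc_subset hx hy)).intervalIntegrable
  have h0 : (0 : ℝ) ∈ Set.Icc 0 b := ⟨le_rfl, hb.le⟩
  have hosc : ∀ x ∈ D, ∀ y ∈ D, edist (F x) (F y) ≤ μ (Set.uIcc x y) := by
    intro x hx y hy
    rw [hμ_apply _ measurableSet_uIcc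
      (Set.ordConnected_Icc.uIcc_subset (hDsub hx) (hDsub hy)), edist_comm, edist_eq_enorm_sub,
      hF, hF, integral_interval_sub_left (hint _ h0 _ (hDsub hy)) (hint _ h0 _ (hDsub hx)),
      ← ofReal_norm, norm_integral_eq_norm_integral_uIoc, ofReal_norm]
    exact (enorm_integral_le_lintegral_enorm _).trans
      (lintegral_mono_set Set.uIoc_subset_uIcc)
  calc volume (F '' D) ≤ μ D := volume_image_le_measure hosc
    _ = ∫⁻ s in D, ‖f s‖ₑ := hμ_apply D hD hDsub
    _ = ENNReal.ofReal (∫ s in D, |f s|) :=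
        (ofReal_integral_norm_eq_lintegral_enorm (hf.mono_set hDsub)).symm
end

section
/- Let (X,μ) be a standard measure space with a sigma-finite measure μ, let S be an invertible measure-preserving transformation of (X,μ) that is ergodic and conservative, and let f : X → ℝ be integrable with ∫_X f dμ = 0. Then the cylindrical cascade C : X × ℝ → X × ℝ defined by C(x,r) = (S x, r + f(x)) is conservative with respect to the product of μ with Lebesgue measure on ℝ. -/
open MeasureTheory Filter

/-- The maximum of `0` and of the first `n` Birkhoff sums of `g` along `T`, defined recursively. -/
noncomputable def birkhoffMax {X : Type*} (T : X → X) (g : X → ℝ) : ℕ → X → ℝ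
  | 0 => fun _ => 0
  | n + 1 => fun x => max 0 (g x + birkhoffMax T g n (T x))

section BirkhoffMax

variable {X : Type*} (T : X → X) (g : X → ℝ)

lemma birkhoffMax_nonneg (n : ℕ) (x : X) : 0 ≤ birkhoffMax T g n x := by
  cases n with
  | zero => exact le_rfl
  | succ n => exact le_max_left _ _

lemma birkhoffMax_le_succ (n : ℕ) (x : X) :
    birkhoffMax T g n x ≤ birkhoffMax T g (n + 1) x := by
  induction n generalizing x with
  | zero => exact birkhoffMax_nonneg T g 1 x
  | succ n ih => exact max_le_max le_rfl (by gcongr; exact ih (T x))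

lemma birkhoffMax_mono (x : X) : Monotone fun n => birkhoffMax T g n x :=
  monotone_nat_of_le_succ fun n => birkhoffMax_le_succ T g n x

lemma birkhoffSum_le_birkhoffMax (n : ℕ) (x : X) :
    birkhoffSum T g n x ≤ birkhoffMax T g n x := by
  induction n generalizing x with
  | zero => simp [birkhoffMax]
  | succ n ih =>
    rw [birkhoffSum_succ']
    exact (add_le_add_right (ih (T x)) _).trans (le_max_right _ _)

variable {T g}

lemma bddAbove_range_birkhoffSum_comp_iff (x : X) :
    BddAbove (Set.range fun n => birkhoffSum T g n (T x)) ↔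
      BddAbove (Set.range fun n => birkhoffSum T g n x) := by
  constructor
  · rintro ⟨K, hK⟩
    refine ⟨max 0 (g x + K), ?_⟩
    rintro _ ⟨n, rfl⟩
    cases n with
    | zero => simp
    | succ n =>
      have := hK ⟨n, rfl⟩
      simp only [birkhoffSum_succ'] at this ⊢
      exact le_max_of_le_right (by linarith)
  · rintro ⟨K, hK⟩
    refine ⟨K - g x, ?_⟩
    rintro _ ⟨n, rfl⟩
    have := hK ⟨n + 1, rfl⟩
    simp only [birkhoffSum_succ'] at this ⊢
    linarith

variable [MeasurableSpace X] {μ : Measure X}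

lemma integrable_birkhoffMax (hT : MeasurePreserving T μ μ) (hg : Integrable g μ) (n : ℕ) :
    Integrable (birkhoffMax T g n) μ := by
  induction n with
  | zero => exact integrable_zero _ _ _
  | succ n ih => exact (integrable_zero _ _ _).sup (hg.add (hT.integrable_comp_of_integrable ih))

/-- **Hopf's maximal ergodic lemma**: if almost every point has a positive Birkhoff sum of `g`,
then `g` has nonnegative integral. -/
theorem integral_nonneg_of_ae_exists_birkhoffSum_pos (hT : MeasurePreserving T μ μ)
    (hg : Integrable g μ) (hpos : ∀ᵐ x ∂μ, ∃ n, 0 < birkhoffSum T g n x) :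
    0 ≤ ∫ x, g x ∂μ := by
  have hint := integrable_birkhoffMax hT hg
  let F : ℕ → X → ℝ := fun n x => if 0 < birkhoffMax T g (n + 1) x then g x else 0
  have hFle (n : ℕ) (x : X) :
      birkhoffMax T g (n + 1) x - birkhoffMax T g n (T x) ≤ F n x := by
    have h0 := birkhoffMax_nonneg T g n (T x)
    by_cases hx : 0 < birkhoffMax T g (n + 1) x
    · simp only [F, if_pos hx]
      have : birkhoffMax T g (n + 1) x = max 0 (g x + birkhoffMax T g n (T x)) := rfl
      rcases le_total 0 (g x + birkhoffMax T g n (T x)) with h | h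
      · rw [this, max_eq_right h]; linarith
      · rw [this, max_eq_left h] at hx; exact absurd hx (lt_irrefl 0)
    · simp only [F, if_neg hx]
      linarith
  have hFmeas (n : ℕ) : AEStronglyMeasurable (F n) μ := by
    have hset : NullMeasurableSet {x | 0 < birkhoffMax T g (n + 1) x} μ :=
      nullMeasurableSet_lt aemeasurable_const (hint (n + 1)).aemeasurable
    exact (hg.aestronglyMeasurable.indicator₀ hset).congr
      (Eventually.of_forall fun x => by simp [F, Set.indicator_apply])
  have hFbound (n : ℕ) : ∀ᵐ x ∂μ, ‖F n x‖ ≤ ‖g x‖ := by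
    refine Eventually.of_forall fun x => ?_
    simp only [F]
    split_ifs <;> simp
  have hlim : Tendsto (fun n => ∫ x, F n x ∂μ) atTop (nhds (∫ x, g x ∂μ)) := by
    refine tendsto_integral_of_dominated_convergence _ hFmeas hg.norm hFbound ?_
    filter_upwards [hpos] with x ⟨k, hk⟩
    refine tendsto_const_nhds.congr' ?_
    filter_upwards [eventually_ge_atTop k] with n hn
    have : 0 < birkhoffMax T g (n + 1) x :=
      hk.trans_le ((birkhoffSum_le_birkhoffMax T g k x).trans
        (birkhoffMax_mono T g x (hn.trans n.le_succ)))
    simp [F, this]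
  refine ge_of_tendsto' hlim fun n => ?_
  have hcomp : ∫ x, birkhoffMax T g n (T x) ∂μ = ∫ x, birkhoffMax T g n x ∂μ := by
    conv_rhs => rw [← hT.map_eq]
    refine (integral_map hT.aemeasurable ?_).symm
    rw [hT.map_eq]
    exact (hint n).aestronglyMeasurable
  have hcompint : Integrable (fun x => birkhoffMax T g n (T x)) μ :=
    hT.integrable_comp_of_integrable (hint n)
  calc 0 ≤ ∫ x, birkhoffMax T g (n + 1) x ∂μ - ∫ x, birkhoffMax T g n x ∂μ :=
        sub_nonneg.2 (integral_mono (hint n) (hint (n + 1)) (birkhoffMax_le_succ T g n))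
    _ = ∫ x, (birkhoffMax T g (n + 1) x - birkhoffMax T g n (T x)) ∂μ := by
        rw [integral_sub (hint (n + 1)) hcompint, hcomp]
    _ ≤ ∫ x, F n x ∂μ :=
        integral_mono ((hint (n + 1)).sub hcompint) (hg.mono (hFmeas n) (hFbound n)) (hFle n)

lemma measurable_birkhoffSum (hT : Measurable T) (hg : Measurable g) (n : ℕ) :
    Measurable (birkhoffSum T g n) :=
  Finset.measurable_fun_sum _ fun i _ => hg.comp (hT.iterate i)

/-- Along an ergodic map, possibly of an infinite measure, the Birkhoff sums of a function with
negative integral are almost everywhere bounded above. -/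
theorem Ergodic.ae_bddAbove_birkhoffSum (hT : Ergodic T μ) (hg : Integrable g μ)
    (hneg : ∫ x, g x ∂μ < 0) :
    ∀ᵐ x ∂μ, BddAbove (Set.range fun n => birkhoffSum T g n x) := by
  have hgm := hg.aestronglyMeasurable.aemeasurable
  have hae : ∀ᵐ x ∂μ, ∀ n, birkhoffSum T g n x = birkhoffSum T (hgm.mk g) n x :=
    ae_all_iff.2
      (hT.toMeasurePreserving.quasiMeasurePreserving.birkhoffSum_ae_eq_of_ae_eq hgm.ae_eq_mk)
  have hmeas : MeasurableSet {x | BddAbove (Set.range fun n => birkhoffSum T (hgm.mk g) n x)} :=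
    measurableSet_bddAbove_range (measurable_birkhoffSum hT.measurable hgm.measurable_mk)
  rcases hT.toPreErgodic.ae_mem_or_ae_notMem hmeas
    (Set.ext fun x => bddAbove_range_birkhoffSum_comp_iff x) with h | h
  · filter_upwards [h, hae] with x hx hxe
    simpa only [hxe] using hx
  · refine absurd (integral_nonneg_of_ae_exists_birkhoffSum_pos hT.toMeasurePreserving hg ?_)
      hneg.not_ge
    filter_upwards [h, hae] with x hx hxe
    by_contra! hcon
    refine hx ⟨0, ?_⟩
    rintro _ ⟨n, rfl⟩
    exact (hxe n).symm.trans_le (hcon n)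

/-- Along an ergodic map, the Birkhoff sums of a function `f` of integral zero are almost
everywhere dominated by those of a function `φ` of positive integral. -/
theorem Ergodic.ae_exists_abs_birkhoffSum_le (hT : Ergodic T μ) {f φ : X → ℝ}
    (hf : Integrable f μ) (hf0 : ∫ x, f x ∂μ = 0) (hφ : Integrable φ μ)
    (hφpos : 0 < ∫ x, φ x ∂μ) {ε : ℝ} (hε : 0 < ε) :
    ∀ᵐ x ∂μ, ∃ K, 0 ≤ K ∧ ∀ n, |birkhoffSum T f n x| ≤ ε * birkhoffSum T φ n x + K := by
  have hεφ := hφ.const_mul ε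
  have hpos : 0 < ε * ∫ x, φ x ∂μ := mul_pos hε hφpos
  have h₁ := hT.ae_bddAbove_birkhoffSum (hf.sub hεφ) (by
    simp only [Pi.sub_apply]
    rw [integral_sub hf hεφ, integral_const_mul, hf0]; linarith)
  have h₂ := hT.ae_bddAbove_birkhoffSum (hf.neg.sub hεφ) (by
    simp only [Pi.sub_apply, Pi.neg_apply]
    rw [integral_sub hf.fun_neg hεφ, integral_const_mul, integral_neg, hf0]; linarith)
  filter_upwards [h₁, h₂] with x ⟨K₁, hK₁⟩ ⟨K₂, hK₂⟩
  refine ⟨max 0 (max K₁ K₂), le_max_left _ _, fun n => ?_⟩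
  have h1 := hK₁ ⟨n, rfl⟩
  have h2 := hK₂ ⟨n, rfl⟩
  simp only [birkhoffSum, Pi.sub_apply, Pi.neg_apply, Finset.sum_sub_distrib,
    Finset.sum_neg_distrib, ← Finset.mul_sum] at h1 h2
  have h3 := (le_max_left K₁ K₂).trans (le_max_right 0 (max K₁ K₂))
  have h4 := (le_max_right K₁ K₂).trans (le_max_right 0 (max K₁ K₂))
  rw [abs_le]
  simp only [birkhoffSum]
  constructor <;> linarith

/-- Along a conservative map, a nonnegative function whose Birkhoff sums are almost everywhere
bounded above vanishes almost everywhere. -/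
theorem MeasureTheory.Conservative.ae_eq_zero_of_bddAbove_birkhoffSum (hT : Conservative T μ)
    (hg : Measurable g) (hg0 : 0 ≤ g)
    (hbdd : ∀ᵐ x ∂μ, BddAbove (Set.range fun n => birkhoffSum T g n x)) : g =ᵐ[μ] 0 := by
  have hrec : ∀ᵐ x ∂μ, ∀ k : ℕ, 1 / ((k : ℝ) + 1) ≤ g x →
      ∃ᶠ n in atTop, 1 / ((k : ℝ) + 1) ≤ g (T^[n] x) :=
    ae_all_iff.2 fun k => hT.ae_mem_imp_frequently_image_mem
      (measurableSet_le measurable_const hg).nullMeasurableSet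
  filter_upwards [hrec, hbdd] with x hx ⟨K, hK⟩
  by_contra hne
  obtain ⟨k, hk⟩ := exists_nat_one_div_lt (lt_of_le_of_ne (hg0 x) (Ne.symm hne))
  have hsum : Summable fun n => g (T^[n] x) :=
    summable_of_sum_range_le (fun n => hg0 _) fun n => hK ⟨n, rfl⟩
  have hlt := hsum.tendsto_atTop_zero.eventually_lt_const (Nat.one_div_pos_of_nat (α := ℝ) (n := k))
  obtain ⟨n, hn, hn'⟩ := ((hx k hk.le).and_eventually hlt).exists
  exact hn.not_gt hn'

end BirkhoffMax

lemma iterate_cylindricalCascade {X : Type*} (T : X → X) (f : X → ℝ) (n : ℕ) (p : X × ℝ) :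
    (fun p : X × ℝ => (T p.1, p.2 + f p.1))^[n] p = (T^[n] p.1, p.2 + birkhoffSum T f n p.1) := by
  induction n generalizing p with
  | zero => simp
  | succ n ih => simp [Function.iterate_succ_apply, ih, birkhoffSum_succ', add_assoc]

/-- If the fibres of `B` over an orbit, translated by the cocycle, are almost disjoint subsets of
a bounded interval, then their total length is at most that of the interval. -/
lemma birkhoffSum_volume_fiber_le {X : Type*} [MeasurableSpace X] (T : X → X) (f : X → ℝ)
    {B : Set (X × ℝ)} (hB : MeasurableSet B) {M : ℝ} (hM : ∀ p ∈ B, |p.2| ≤ M) {x : X}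
    (hx : ∀ i n, 1 ≤ n → ∀ᵐ r : ℝ, ¬ ((T^[i] x, r) ∈ B ∧
      (T^[n] (T^[i] x), r + birkhoffSum T f n (T^[i] x)) ∈ B))
    {N : ℕ} {R : ℝ} (hMR : 0 ≤ M + R) (hR : ∀ i < N, |birkhoffSum T f i x| ≤ R) :
    birkhoffSum T (fun y => volume.real (Prod.mk y ⁻¹' B)) N x ≤ 2 * (M + R) := by
  let A : ℕ → Set ℝ := fun i => (· + birkhoffSum T f i x) ⁻¹' (Prod.mk (T^[i] x) ⁻¹' B)
  have hAm (i : ℕ) : MeasurableSet (A i) :=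
    (measurable_add_const _) (measurable_prodMk_left hB)
  have hAv (i : ℕ) : volume (A i) = volume (Prod.mk (T^[i] x) ⁻¹' B) :=
    measure_preimage_add_right _ _ _
  have hlt {i j : ℕ} (hij : i < j) : AEDisjoint volume (A i) (A j) := by
    obtain ⟨n, rfl⟩ := Nat.exists_eq_add_of_le hij.le
    have h := (measurePreserving_add_right (volume : Measure ℝ)
      (birkhoffSum T f i x)).quasiMeasurePreserving.ae (hx i n (by omega))
    refine measure_mono_null ?_ (ae_iff.1 h)
    rintro r ⟨h1, h2⟩
    simp only [Set.mem_ofPred_eq, not_not]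
    refine ⟨h1, ?_⟩
    rw [← Function.iterate_add_apply, add_comm n i, add_assoc, ← birkhoffSum_add]
    exact h2
  have hdisj : Set.Pairwise (↑(Finset.range N)) (Function.onFun (AEDisjoint volume) A) := by
    intro i _ j _ hij
    rcases hij.lt_or_gt with h | h
    · exact hlt h
    · exact (hlt h).symm
  have hsub : ⋃ i ∈ Finset.range N, A i ⊆ Set.Icc (-(M + R)) (M + R) := by
    refine Set.iUnion₂_subset fun i hi r hr => ?_
    have h1 := abs_le.1 (hM _ hr)
    have h2 := abs_le.1 (hR i (Finset.mem_range.1 hi))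
    simp only at h1
    constructor <;> linarith
  have hsum : ∑ i ∈ Finset.range N, volume (A i) ≤ ENNReal.ofReal (2 * (M + R)) := by
    rw [← measure_biUnion_finset₀ hdisj fun i _ => (hAm i).nullMeasurableSet]
    refine (measure_mono hsub).trans_eq ?_
    rw [Real.volume_Icc]
    ring_nf
  have hfin (i : ℕ) (hi : i ∈ Finset.range N) : volume (A i) ≠ ⊤ :=
    (((Finset.single_le_sum (fun _ _ => zero_le) hi).trans hsum).trans_lt
      ENNReal.ofReal_lt_top).ne
  simp only [birkhoffSum, Measure.real, ← hAv]
  rw [← ENNReal.toReal_sum hfin]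
  exact ENNReal.toReal_le_of_le_ofReal (by positivity) hsum

/-- The cylindrical cascade over a conservative ergodic map with a zero-mean integrable cocycle
has no wandering set of finite positive measure and bounded height. -/
theorem measure_eq_zero_of_wandering_cylindricalCascade {X : Type*} [MeasurableSpace X]
    {μ : Measure X} [SigmaFinite μ] {T : X → X} (hT : Ergodic T μ) (hTc : Conservative T μ)
    {f : X → ℝ} (hf : Integrable f μ) (hf0 : ∫ x, f x ∂μ = 0) {B : Set (X × ℝ)}
    (hB : MeasurableSet B) (hBfin : (μ.prod volume) B ≠ ⊤) {M : ℝ} (hM : ∀ p ∈ B, |p.2| ≤ M)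
    (hwander : ∀ n : ℕ, 1 ≤ n → (μ.prod volume)
      (B ∩ ((fun p : X × ℝ => (T p.1, p.2 + f p.1))^[n]) ⁻¹' B) = 0) :
    (μ.prod volume) B = 0 := by
  set φ : X → ℝ := fun y => volume.real (Prod.mk y ⁻¹' B) with hφdef
  have hφm : Measurable φ := (measurable_measure_prodMk_left hB).ennreal_toReal
  have hφ0 : 0 ≤ φ := fun _ => ENNReal.toReal_nonneg
  have hφi : Integrable φ μ := Measure.integrable_measure_prodMk_left hB hBfin
  have hzero : φ =ᵐ[μ] 0 → (μ.prod volume) B = 0 := by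
    intro h
    refine (Measure.measure_prod_null hB).2 ?_
    filter_upwards [h, Measure.ae_measure_lt_top hB hBfin] with x hx hx'
    exact (ENNReal.toReal_eq_zero_iff _).1 hx |>.resolve_right hx'.ne
  by_contra hne
  have hφpos : 0 < ∫ x, φ x ∂μ := by
    refine (integral_nonneg hφ0).lt_of_ne fun h => hne (hzero ?_)
    exact (integral_eq_zero_iff_of_nonneg hφ0 hφi).1 h.symm
  have hfiber : ∀ᵐ x ∂μ, ∀ n, 1 ≤ n → ∀ᵐ r : ℝ,
      ¬ ((x, r) ∈ B ∧ (T^[n] x, r + birkhoffSum T f n x) ∈ B) := by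
    refine ae_all_iff.2 fun n => eventually_imp_distrib_left.2 fun hn => ?_
    refine Measure.ae_ae_of_ae_prod (p := fun z : X × ℝ => ¬ (z ∈ B ∧
      (T^[n] z.1, z.2 + birkhoffSum T f n z.1) ∈ B)) ?_
    filter_upwards [measure_eq_zero_iff_ae_notMem.1 (hwander n hn)] with z hz hz'
    exact hz ⟨hz'.1, by rw [Set.mem_preimage, iterate_cylindricalCascade]; exact hz'.2⟩
  have horbit : ∀ᵐ x ∂μ, ∀ i n, 1 ≤ n → ∀ᵐ r : ℝ, ¬ ((T^[i] x, r) ∈ B ∧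
      (T^[n] (T^[i] x), r + birkhoffSum T f n (T^[i] x)) ∈ B) :=
    ae_all_iff.2 fun i => (hTc.toQuasiMeasurePreserving.iterate i).ae hfiber
  refine hne (hzero (hTc.ae_eq_zero_of_bddAbove_birkhoffSum hφm hφ0 ?_))
  filter_upwards [horbit, hT.ae_exists_abs_birkhoffSum_le hf hf0 hφi hφpos
    (ε := 1 / 4) (by norm_num)] with x hx ⟨K, hK0, hK⟩
  refine ⟨4 * (|M| + K), ?_⟩
  rintro _ ⟨N, rfl⟩
  have hmono {i j : ℕ} (hij : i ≤ j) : birkhoffSum T φ i x ≤ birkhoffSum T φ j x :=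
    Finset.sum_le_sum_of_subset_of_nonneg (Finset.range_mono hij) fun _ _ _ => hφ0 _
  have hN0 : 0 ≤ birkhoffSum T φ N x := Finset.sum_nonneg fun _ _ => hφ0 _
  have := birkhoffSum_volume_fiber_le T f hB (fun p hp => (hM p hp).trans (le_abs_self M)) hx
    (N := N) (R := 1 / 4 * birkhoffSum T φ N x + K) (by positivity)
    fun i hi => (hK i).trans (by linarith [hmono hi.le])
  rw [← hφdef] at this
  simp only
  linarith

/-- Theorem 3: over a standard space with a sigma-finite measure, the cylindrical
cascade `C(x, r) = (S x, r + f x)` over an ergodic conservative automorphism `S`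
with an integrable zero-mean cocycle `f` is conservative for `μ × Lebesgue`. -/
theorem cylindrical_cascade_conservative_sigmaFinite
    {X : Type*} [MeasurableSpace X] [StandardBorelSpace X]
    (μ : Measure X) [SigmaFinite μ]
    (S : X ≃ᵐ X) (hS : MeasurePreserving S μ μ)
    (hSerg : ∀ E : Set X, MeasurableSet E → (⇑S) ⁻¹' E =ᵐ[μ] E →
      μ E = 0 ∨ μ Eᶜ = 0)
    (hScons : ∀ B : Set X, MeasurableSet B → 0 < μ B →
      ∃ n : ℕ, 1 ≤ n ∧ 0 < μ (B ∩ (⇑S)^[n] ⁻¹' B))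
    (f : X → ℝ) (hf : Integrable f μ) (hf0 : ∫ x, f x ∂μ = 0) :
    ∀ B : Set (X × ℝ), MeasurableSet B → 0 < (μ.prod volume) B →
      ∃ n : ℕ, 1 ≤ n ∧
        0 < (μ.prod volume)
          (B ∩ ((fun p : X × ℝ => (S p.1, p.2 + f p.1))^[n]) ⁻¹' B) := by
  have hT : Ergodic S μ :=
    { hS with
      aeconst_set := fun E hE hinv => by
        rw [eventuallyConst_set']
        rcases hSerg E hE hinv.eventuallyEq with h | h
        · exact Or.inl (ae_eq_empty.2 h)
        · exact Or.inr (ae_eq_univ.2 h) }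
  have hTc : Conservative S μ :=
    { hS.quasiMeasurePreserving with
      exists_mem_iterate_mem' := fun E hE hpos => by
        obtain ⟨n, hn, hpos'⟩ := hScons E hE (pos_iff_ne_zero.2 hpos)
        obtain ⟨x, hx, hx'⟩ := nonempty_of_measure_ne_zero hpos'.ne'
        exact ⟨x, hx, n, by omega, hx'⟩ }
  intro B hB hpos
  by_contra! hcon
  let W : ℕ → Set (X × ℝ) := fun k =>
    B ∩ (spanningSets μ k ×ˢ Set.Icc (-(k : ℝ)) k)
  have hWzero (k : ℕ) : (μ.prod volume) (W k) = 0 := by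
    refine measure_eq_zero_of_wandering_cylindricalCascade hT hTc hf hf0 (M := k)
      (hB.inter ((measurableSet_spanningSets μ k).prod measurableSet_Icc)) ?_
      (fun p hp => abs_le.2 hp.2.2) fun n hn => ?_
    · refine ((measure_mono Set.inter_subset_right).trans_lt ?_).ne
      rw [Measure.prod_prod]
      exact ENNReal.mul_lt_top (measure_spanningSets_lt_top μ k) measure_Icc_lt_top
    · exact measure_mono_null
        (Set.inter_subset_inter Set.inter_subset_left
          (Set.preimage_mono Set.inter_subset_left)) (nonpos_iff_eq_zero.1 (hcon n hn))
  refine hpos.ne' (measure_mono_null (fun p hp => ?_) (measure_iUnion_null hWzero))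
  obtain ⟨i, hi⟩ := Set.mem_iUnion.1 ((iUnion_spanningSets μ).symm ▸ Set.mem_univ p.1)
  obtain ⟨j, hj⟩ := exists_nat_ge |p.2|
  have hj' : |p.2| ≤ ((max i j : ℕ) : ℝ) := hj.trans (by exact_mod_cast le_max_right i j)
  exact Set.mem_iUnion.2 ⟨max i j, hp,
    monotone_spanningSets μ (le_max_left i j) hi, abs_le.1 hj'⟩
end

section
/- (Krygin–Atkinson) Let S be an ergodic measure-preserving invertible transformation of a probability space (X,μ) and let f : X → ℝ be integrable with ∫_X f dμ = 0. Then the cylindrical cascade C : X × ℝ → X × ℝ defined by C(x,r) = (S x, r + f(x)) is conservative with respect to the product of μ with Lebesgue measure on ℝ. -/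
open MeasureTheory Filter

section MeanErgodic

variable {X : Type*} [MeasurableSpace X] {μ : Measure X} {S : X → X}

theorem integral_abs_le_norm_of_Lp_two [IsProbabilityMeasure μ] (H : Lp ℝ 2 μ) :
    ∫ x, |H x| ∂μ ≤ ‖H‖ := by
  have h1 : eLpNorm H 1 μ ≤ eLpNorm H 2 μ :=
    eLpNorm_le_eLpNorm_of_exponent_le (by norm_num) (Lp.aestronglyMeasurable H)
  have h2 : ∫ x, |H x| ∂μ = (eLpNorm H 1 μ).toReal := by
    rw [eLpNorm_one_eq_lintegral_enorm, ← integral_norm_eq_lintegral_enorm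
      (Lp.aestronglyMeasurable H)]
    rfl
  rw [h2, Lp.norm_def]
  exact ENNReal.toReal_mono (Lp.eLpNorm_ne_top H) h1

theorem coeFn_birkhoffSum_compMeasurePreserving (hS : MeasurePreserving S μ μ)
    (G : Lp ℝ 2 μ) (n : ℕ) :
    (birkhoffSum (Lp.compMeasurePreserving S hS) id n G : Lp ℝ 2 μ) =ᵐ[μ]
      birkhoffSum S G n := by
  induction n with
  | zero =>
    simp only [birkhoffSum_zero, birkhoffSum_zero']
    exact Lp.coeFn_zero ℝ 2 μ
  | succ n ih =>
    rw [birkhoffSum_succ, Lp.compMeasurePreserving_iterate hS n]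
    refine (Lp.coeFn_add _ _).trans ?_
    filter_upwards [ih, Lp.coeFn_compMeasurePreserving G (hS.iterate n)] with x h1 h2
    rw [Pi.add_apply, h1, birkhoffSum_succ, id, h2]
    rfl

/-- Mean ergodic theorem for square integrable functions, in the `L¹` sense. -/
theorem Ergodic.exists_eventually_integral_abs_birkhoffSum_sub_le [IsProbabilityMeasure μ]
    (hS : Ergodic S μ) {g : X → ℝ} (hg : MemLp g 2 μ) :
    ∃ c : ℝ, ∀ δ > 0, ∀ᶠ n : ℕ in atTop,
      ∫ x, |birkhoffSum S g n x - n * c| ∂μ ≤ δ * n := by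
  have hSp := hS.toMeasurePreserving
  let G : Lp ℝ 2 μ := hg.toLp g
  let U : Lp ℝ 2 μ →ₗᵢ[ℝ] Lp ℝ 2 μ := Lp.compMeasurePreservingₗᵢ ℝ S hSp
  have hU : ⇑U.toContinuousLinearMap = Lp.compMeasurePreserving S hSp := rfl
  have hlim := U.toContinuousLinearMap.tendsto_birkhoffAverage_orthogonalProjection
    U.norm_toContinuousLinearMap_le G
  set P := (U.toContinuousLinearMap.eqLocus
    (1 : Lp ℝ 2 μ →L[ℝ] Lp ℝ 2 μ)).orthogonalProjectionOnto G with hP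
  have hfix : Lp.compMeasurePreserving S hSp (P : Lp ℝ 2 μ) = P := P.2
  obtain ⟨c, hc⟩ := hS.ae_eq_const_of_ae_eq_comp_ae (g := ((P : Lp ℝ 2 μ) : X → ℝ))
    (Lp.aestronglyMeasurable _)
    ((Lp.coeFn_compMeasurePreserving (P : Lp ℝ 2 μ) hSp).symm.trans (by rw [hfix]))
  refine ⟨c, fun δ hδ => ?_⟩
  filter_upwards [(Metric.tendsto_nhds.1 hlim) δ hδ, eventually_gt_atTop 0] with n hn hn0
  rw [dist_eq_norm] at hn
  have hn0' : (0 : ℝ) < n := by exact_mod_cast hn0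
  have key := (integral_abs_le_norm_of_Lp_two _).trans hn.le
  have hae : (fun x => |birkhoffSum S g n x - n * c|) =ᵐ[μ] fun x => (n : ℝ) *
      |(birkhoffAverage ℝ U.toContinuousLinearMap id n G - (P : Lp ℝ 2 μ) : Lp ℝ 2 μ) x| := by
    have hsum := coeFn_birkhoffSum_compMeasurePreserving hSp G n
    have hgG := hSp.quasiMeasurePreserving.birkhoffSum_ae_eq_of_ae_eq hg.coeFn_toLp n
    rw [birkhoffAverage, hU]
    filter_upwards [hsum, hgG, hc, Lp.coeFn_sub
      ((n : ℝ)⁻¹ • birkhoffSum (Lp.compMeasurePreserving S hSp) id n G) (P : Lp ℝ 2 μ),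
      Lp.coeFn_smul (n : ℝ)⁻¹ (birkhoffSum (Lp.compMeasurePreserving S hSp) id n G)]
      with x h1 h2 h3 h4 h5
    rw [h4, Pi.sub_apply, h5, Pi.smul_apply, h1, h2, h3, ← abs_of_pos hn0', ← abs_mul,
      abs_of_pos hn0']
    congr 1
    simp only [smul_eq_mul, Function.const]
    field_simp
  rw [integral_congr_ae hae, integral_const_mul, mul_comm]
  gcongr

theorem integrable_birkhoffSum (hS : MeasurePreserving S μ μ) {f : X → ℝ}
    (hf : Integrable f μ) (n : ℕ) : Integrable (birkhoffSum S f n) μ :=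
  integrable_finsetSum _ fun k _ => (hS.iterate k).integrable_comp_of_integrable hf

theorem integral_birkhoffSum (hS : MeasurePreserving S μ μ) {f : X → ℝ}
    (hf : Integrable f μ) (n : ℕ) : ∫ x, birkhoffSum S f n x ∂μ = n * ∫ x, f x ∂μ := by
  have h : ∀ k, ∫ x, f (S^[k] x) ∂μ = ∫ x, f x ∂μ := fun k => by
    conv_rhs => rw [← (hS.iterate k).map_eq]
    rw [integral_map (hS.iterate k).aemeasurable]
    rw [(hS.iterate k).map_eq]
    exact hf.aestronglyMeasurable
  simp only [birkhoffSum]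
  rw [integral_finsetSum (f := fun k x => f (S^[k] x)) _
    fun k _ => (hS.iterate k).integrable_comp_of_integrable hf]
  simp [h]

theorem integral_abs_birkhoffSum_le (hS : MeasurePreserving S μ μ) {f : X → ℝ}
    (hf : Integrable f μ) (n : ℕ) :
    ∫ x, |birkhoffSum S f n x| ∂μ ≤ n * ∫ x, |f x| ∂μ := by
  rw [← integral_birkhoffSum hS hf.abs]
  refine integral_mono (integrable_birkhoffSum hS hf n).abs
    (integrable_birkhoffSum hS hf.abs n) fun x => ?_
  exact Finset.abs_sum_le_sum_abs _ _

/-- The Birkhoff sums of a zero-mean function over an ergodic map grow sublinearly in `L¹`. -/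
theorem Ergodic.exists_integral_abs_birkhoffSum_le [IsProbabilityMeasure μ]
    (hS : Ergodic S μ) {f : X → ℝ} (hf : Integrable f μ) (hf0 : ∫ x, f x ∂μ = 0)
    {δ : ℝ} (hδ : 0 < δ) :
    ∃ K : ℝ, 0 ≤ K ∧ ∀ n : ℕ, ∫ x, |birkhoffSum S f n x| ∂μ ≤ δ * n + K := by
  have hSp := hS.toMeasurePreserving
  obtain ⟨g, hfg, hg1⟩ := (memLp_one_iff_integrable.2 hf).exists_simpleFunc_eLpNorm_sub_lt
    ENNReal.one_ne_top (ε := ENNReal.ofReal (δ / 4)) (by simpa using hδ)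
  have hgi : Integrable g μ := memLp_one_iff_integrable.1 hg1
  have hfgi : Integrable (f - ⇑g) μ := hf.sub hgi
  have hfg' : ∫ x, |(f - ⇑g) x| ∂μ ≤ δ / 4 := by
    have h := integral_norm_eq_lintegral_enorm hfgi.aestronglyMeasurable
    rw [← eLpNorm_one_eq_lintegral_enorm] at h
    simp only [Real.norm_eq_abs] at h
    rw [h]
    exact ENNReal.toReal_le_of_le_ofReal (by positivity) hfg.le
  have hg2 : MemLp g 2 μ := g.memLp_of_isFiniteMeasure 2 μ
  obtain ⟨c, hc⟩ := hS.exists_eventually_integral_abs_birkhoffSum_sub_le hg2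
  obtain ⟨N, hN⟩ := eventually_atTop.1 (hc (δ / 4) (by positivity))
  have hint := integrable_birkhoffSum hSp hf
  have hbig : ∀ n ≥ N, ∫ x, |birkhoffSum S f n x| ∂μ ≤ δ * n := by
    intro n hn
    have hi1 : Integrable (fun x => birkhoffSum S g n x - n * c) μ :=
      (integrable_birkhoffSum hSp hgi n).sub (integrable_const _)
    have hi2 : Integrable (fun x => birkhoffSum S f n x - n * c) μ :=
      (hint n).sub (integrable_const _)
    have h1 : ∫ x, |birkhoffSum S f n x - n * c| ∂μ ≤ δ / 2 * n := by
      calc ∫ x, |birkhoffSum S f n x - n * c| ∂μ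
          ≤ ∫ x, (|birkhoffSum S (f - ⇑g) n x| + |birkhoffSum S g n x - n * c|) ∂μ := by
            refine integral_mono hi2.abs
              ((integrable_birkhoffSum hSp hfgi n).abs.add hi1.abs) fun x => ?_
            have : birkhoffSum S f n x - n * c =
                birkhoffSum S (f - ⇑g) n x + (birkhoffSum S g n x - n * c) := by
              simp [birkhoffSum, Finset.sum_sub_distrib]
            simp only [this]
            exact abs_add_le _ _
        _ = ∫ x, |birkhoffSum S (f - ⇑g) n x| ∂μ +
            ∫ x, |birkhoffSum S g n x - n * c| ∂μ :=
            integral_add (integrable_birkhoffSum hSp hfgi n).abs hi1.abs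
        _ ≤ n * (δ / 4) + δ / 4 * n := by
            refine add_le_add ((integral_abs_birkhoffSum_le hSp hfgi n).trans ?_) (hN n hn)
            gcongr
        _ = δ / 2 * n := by ring
    have h2 : |n * c| ≤ δ / 2 * n := by
      refine le_trans ?_ h1
      have h3 : ∫ x, (birkhoffSum S f n x - n * c) ∂μ = -(n * c) := by
        rw [integral_sub (hint n) (integrable_const _), integral_birkhoffSum hSp hf, hf0]
        simp
      rw [← abs_neg, ← h3]
      exact abs_integral_le_integral_abs
    calc ∫ x, |birkhoffSum S f n x| ∂μ
        ≤ ∫ x, (|birkhoffSum S f n x - n * c| + |n * c|) ∂μ := by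
          refine integral_mono (hint n).abs (hi2.abs.add (integrable_const _)) fun x => ?_
          simpa using abs_add_le (birkhoffSum S f n x - n * c) (n * c)
      _ = ∫ x, |birkhoffSum S f n x - n * c| ∂μ + |n * c| := by
          rw [integral_add hi2.abs (integrable_const _)]
          simp
      _ ≤ δ * n := by linarith
  have hpos : ∀ n, 0 ≤ ∫ x, |birkhoffSum S f n x| ∂μ := fun n =>
    integral_nonneg fun x => abs_nonneg _
  refine ⟨∑ n ∈ Finset.range N, ∫ x, |birkhoffSum S f n x| ∂μ,
    Finset.sum_nonneg fun n _ => hpos n, fun n => ?_⟩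
  rcases lt_or_ge n N with hn | hn
  · have := Finset.single_le_sum (f := fun n => ∫ x, |birkhoffSum S f n x| ∂μ)
      (fun i _ => hpos i) (Finset.mem_range.2 hn)
    have h0 : 0 ≤ δ * n := by positivity
    linarith
  · have := Finset.sum_nonneg (s := Finset.range N) fun n _ => hpos n
    linarith [hbig n hn]

end MeanErgodic

section Cascade

theorem iterate_cylindrical_cascade {X : Type*} (S : X → X) (f : X → ℝ) (n : ℕ) (p : X × ℝ) :
    (fun p : X × ℝ => (S p.1, p.2 + f p.1))^[n] p =
      (S^[n] p.1, p.2 + birkhoffSum S f n p.1) := by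
  induction n with
  | zero => simp
  | succ n ih =>
    rw [Function.iterate_succ_apply', ih, Function.iterate_succ_apply', birkhoffSum_succ,
      add_assoc]

variable {X : Type*} [MeasurableSpace X] {μ : Measure X} {S : X → X}

theorem measurePreserving_cylindrical_cascade [SFinite μ] (hS : MeasurePreserving S μ μ)
    {f : X → ℝ} (hf : Measurable f) :
    MeasurePreserving (fun p : X × ℝ => (S p.1, p.2 + f p.1))
      (μ.prod volume) (μ.prod volume) :=
  hS.skew_product (g := fun x r => r + f x)
    (measurable_snd.add (hf.comp measurable_fst))
    (Eventually.of_forall fun x => (measurePreserving_add_right volume (f x)).map_eq)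

theorem measure_prod_setOf_abs_add_le [SFinite μ] {h : X → ℝ} (hh : Measurable h) {V : Set X}
    (hV : MeasurableSet V) (M : ℝ) :
    (μ.prod volume) {p : X × ℝ | p.1 ∈ V ∧ |p.2 + h p.1| ≤ M} =
      ENNReal.ofReal (2 * M) * μ V := by
  have hm : MeasurableSet {p : X × ℝ | p.1 ∈ V ∧ |p.2 + h p.1| ≤ M} :=
    (measurable_fst hV).inter (measurableSet_le
      (measurable_snd.add (hh.comp measurable_fst)).abs measurable_const)
  rw [Measure.prod_apply hm, ← setLIntegral_const, ← lintegral_indicator hV]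
  refine lintegral_congr fun x => ?_
  by_cases hx : x ∈ V
  · have : Prod.mk x ⁻¹' {p : X × ℝ | p.1 ∈ V ∧ |p.2 + h p.1| ≤ M} =
        Set.Icc (-M - h x) (M - h x) := by
      ext r
      simp only [Set.mem_preimage, Set.mem_ofPred_eq, hx, true_and, abs_le, Set.mem_Icc]
      constructor <;> rintro ⟨h1, h2⟩ <;> constructor <;> linarith
    rw [this, Real.volume_Icc, Set.indicator_of_mem hx]
    congr 1
    ring
  · simp [hx]

/-- Counting bound: the first `N` preimages of a wandering set of bounded height are disjoint,
and up to a small error they all lie in a strip of height `M + R`. -/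
theorem sum_measure_wandering_le [IsProbabilityMeasure μ] (hS : MeasurePreserving S μ μ)
    {f : X → ℝ} (hfm : Measurable f) (hf : Integrable f μ) {B : Set (X × ℝ)}
    (hB : MeasurableSet B) {M : ℝ} (hM : 0 ≤ M) (hBM : ∀ p ∈ B, |p.2| ≤ M)
    (hw : ∀ n : ℕ, 1 ≤ n → (μ.prod volume)
      (B ∩ ((fun p : X × ℝ => (S p.1, p.2 + f p.1))^[n]) ⁻¹' B) = 0)
    (N : ℕ) {R : ℝ} (hR : 0 < R) :
    N * (μ.prod volume).real B ≤ 2 * (M + R) +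
      ∑ n ∈ Finset.range N, 2 * M * ((∫ x, |birkhoffSum S f n x| ∂μ) / R) := by
  set T := fun p : X × ℝ => (S p.1, p.2 + f p.1) with hT
  set ν := μ.prod (volume : Measure ℝ) with hν
  have hTp : MeasurePreserving T ν ν := measurePreserving_cylindrical_cascade hS hfm
  have hbm : ∀ n, Measurable (birkhoffSum S f n) := fun n => by
    exact Finset.measurable_fun_sum _ fun k _ => hfm.comp (hS.iterate k).measurable
  let D : ℕ → Set (X × ℝ) := fun n => T^[n] ⁻¹' B
  let U : Set (X × ℝ) := {p | |p.2| ≤ M + R}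
  let V : ℕ → Set X := fun n => {x | R ≤ |birkhoffSum S f n x|}
  have hD : ∀ n, MeasurableSet (D n) := fun n => (hTp.iterate n).measurable hB
  have hU : MeasurableSet U := measurableSet_le measurable_snd.abs measurable_const
  have hV : ∀ n, MeasurableSet (V n) := fun n => measurableSet_le measurable_const (hbm n).abs
  have hνU : ν U = ENNReal.ofReal (2 * (M + R)) := by
    have := measure_prod_setOf_abs_add_le (μ := μ) (h := fun _ => 0) measurable_const
      MeasurableSet.univ (M + R)
    simpa using this
  have hνD : ∀ n, ν (D n) = ν B := fun n =>
    (hTp.iterate n).measure_preimage hB.nullMeasurableSet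
  have hdisj_lt : ∀ m n, m < n → AEDisjoint ν (D m) (D n) := by
    intro m n hmn
    obtain ⟨k, rfl⟩ := Nat.exists_eq_add_of_lt hmn
    have : D m ∩ D (m + k + 1) = T^[m] ⁻¹' (B ∩ T^[k + 1] ⁻¹' B) := by
      ext p
      simp only [D, Set.mem_inter_iff, Set.mem_preimage, ← Function.iterate_add_apply]
      rw [show k + 1 + m = m + k + 1 by ring]
    rw [AEDisjoint, this, (hTp.iterate m).measure_preimage
      (hB.inter ((hTp.iterate _).measurable hB)).nullMeasurableSet]
    exact hw _ (by omega)
  have hdisj : Pairwise (Function.onFun (AEDisjoint ν) D) := fun m n hmn => by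
    rcases lt_or_gt_of_ne hmn with h | h
    · exact hdisj_lt m n h
    · exact (hdisj_lt n m h).symm
  have hsumU : ∑ n ∈ Finset.range N, ν (D n ∩ U) ≤ ENNReal.ofReal (2 * (M + R)) := by
    rw [← hνU, ← measure_biUnion_finset₀]
    · exact measure_mono (Set.iUnion₂_subset fun n _ => Set.inter_subset_right)
    · exact fun m _ n _ hmn => (hdisj hmn).mono Set.inter_subset_left Set.inter_subset_left
    · exact fun n _ => ((hD n).inter hU).nullMeasurableSet
  have hνV : ∀ n, μ (V n) ≤ ENNReal.ofReal ((∫ x, |birkhoffSum S f n x| ∂μ) / R) := by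
    intro n
    have h := mul_meas_ge_le_integral_of_nonneg (μ := μ) (f := fun x => |birkhoffSum S f n x|)
      (Eventually.of_forall fun x => abs_nonneg _) (integrable_birkhoffSum hS hf n).abs R
    rw [← ofReal_measureReal]
    refine ENNReal.ofReal_le_ofReal ?_
    rw [le_div_iff₀ hR, mul_comm]
    exact h
  have hpos : ∀ n, 0 ≤ 2 * M * ((∫ x, |birkhoffSum S f n x| ∂μ) / R) := fun n =>
    mul_nonneg (by positivity) (div_nonneg (integral_nonneg fun x => abs_nonneg _) hR.le)
  have hterm : ∀ n, ν B ≤ ν (D n ∩ U) +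
      ENNReal.ofReal (2 * M * ((∫ x, |birkhoffSum S f n x| ∂μ) / R)) := by
    intro n
    have hsub : D n ⊆ (D n ∩ U) ∪
        {p : X × ℝ | p.1 ∈ V n ∧ |p.2 + birkhoffSum S f n p.1| ≤ M} := by
      intro p hp
      have hpM : |p.2 + birkhoffSum S f n p.1| ≤ M := by
        have := hBM _ hp
        rwa [iterate_cylindrical_cascade] at this
      by_cases hpV : p.1 ∈ V n
      · exact Or.inr ⟨hpV, hpM⟩
      · refine Or.inl ⟨hp, ?_⟩
        have hlt : |birkhoffSum S f n p.1| < R := not_le.1 hpV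
        have := abs_sub (p.2 + birkhoffSum S f n p.1) (birkhoffSum S f n p.1)
        rw [add_sub_cancel_right] at this
        change |p.2| ≤ M + R
        linarith
    rw [← hνD n]
    refine (measure_mono hsub).trans ((measure_union_le _ _).trans ?_)
    refine add_le_add le_rfl ?_
    rw [measure_prod_setOf_abs_add_le (hbm n) (hV n),
      ENNReal.ofReal_mul (p := 2 * M) (by positivity)]
    exact mul_le_mul_right (hνV n) _
  have htotal : N * ν B ≤ ENNReal.ofReal (2 * (M + R) +
      ∑ n ∈ Finset.range N, 2 * M * ((∫ x, |birkhoffSum S f n x| ∂μ) / R)) := by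
    rw [ENNReal.ofReal_add (by positivity) (Finset.sum_nonneg fun n _ => hpos n),
      ENNReal.ofReal_sum_of_nonneg fun n _ => hpos n]
    calc N * ν B = ∑ n ∈ Finset.range N, ν B := by simp
      _ ≤ _ := Finset.sum_le_sum fun n _ => hterm n
      _ ≤ _ := by
        rw [Finset.sum_add_distrib]
        gcongr
  have := ENNReal.toReal_le_of_le_ofReal
    (add_nonneg (by positivity) (Finset.sum_nonneg fun n _ => hpos n)) htotal
  simpa [Measure.real] using this

theorem measure_eq_zero_of_wandering_of_bounded [IsProbabilityMeasure μ] (hS : Ergodic S μ)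
    {f : X → ℝ} (hfm : Measurable f) (hf : Integrable f μ) (hf0 : ∫ x, f x ∂μ = 0)
    {B : Set (X × ℝ)} (hB : MeasurableSet B) {M : ℝ} (hM : 0 < M) (hBM : ∀ p ∈ B, |p.2| ≤ M)
    (hw : ∀ n : ℕ, 1 ≤ n → (μ.prod volume)
      (B ∩ ((fun p : X × ℝ => (S p.1, p.2 + f p.1))^[n]) ⁻¹' B) = 0) :
    (μ.prod volume) B = 0 := by
  by_contra hne
  have hfin : (μ.prod volume) B ≠ ⊤ := by
    have h := measure_prod_setOf_abs_add_le (μ := μ) (h := fun _ => 0) measurable_const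
      MeasurableSet.univ M
    refine ((measure_mono fun p hp => ?_).trans_lt (h.trans_lt ?_)).ne
    · simpa using hBM p hp
    · exact ENNReal.mul_lt_top ENNReal.ofReal_lt_top (measure_lt_top μ _)
  set b := (μ.prod volume).real B with hb
  have hbpos : 0 < b := ENNReal.toReal_pos hne hfin
  set ε := b / 8 with hε
  have hεpos : 0 < ε := by positivity
  set δ := ε * b / (8 * M) with hδ
  obtain ⟨K, hK, hKn⟩ := hS.exists_integral_abs_birkhoffSum_le hf hf0
    (δ := δ) (by positivity)
  obtain ⟨N, hN⟩ := exists_nat_gt ((4 * M + 4 * M * K / ε) / b)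
  have hN0 : (0 : ℝ) < N := lt_of_le_of_lt (by positivity) hN
  have h := sum_measure_wandering_le hS.toMeasurePreserving hfm hf hB hM.le hBM hw N
    (R := ε * N) (by positivity)
  have hsum : ∑ n ∈ Finset.range N, 2 * M * ((∫ x, |birkhoffSum S f n x| ∂μ) / (ε * N)) ≤
      ∑ n ∈ Finset.range N, 2 * M * ((δ * N + K) / (ε * N)) := by
    refine Finset.sum_le_sum fun n hn => ?_
    have hnN : (n : ℝ) ≤ N := by exact_mod_cast (Finset.mem_range.1 hn).le
    have : ∫ x, |birkhoffSum S f n x| ∂μ ≤ δ * N + K := (hKn n).trans (by gcongr)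
    gcongr
  have heq : ∑ n ∈ Finset.range N, 2 * M * ((δ * N + K) / (ε * N)) =
      N * b / 4 + 2 * M * K / ε := by
    rw [Finset.sum_const, Finset.card_range, nsmul_eq_mul, hδ]
    field_simp
    ring
  rw [div_lt_iff₀ hbpos] at hN
  have h4 : 4 * M * K / ε = 2 * (2 * M * K / ε) := by ring
  have h5 : ε * N = N * b / 8 := by rw [hε]; ring
  rw [h5] at h hsum heq
  linarith

theorem measure_eq_zero_of_wandering [IsProbabilityMeasure μ] (hS : Ergodic S μ)
    {f : X → ℝ} (hfm : Measurable f) (hf : Integrable f μ) (hf0 : ∫ x, f x ∂μ = 0)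
    {B : Set (X × ℝ)} (hB : MeasurableSet B)
    (hw : ∀ n : ℕ, 1 ≤ n → (μ.prod volume)
      (B ∩ ((fun p : X × ℝ => (S p.1, p.2 + f p.1))^[n]) ⁻¹' B) = 0) :
    (μ.prod volume) B = 0 := by
  have hcover : B ⊆ ⋃ k : ℕ, B ∩ {p | |p.2| ≤ k + 1} := by
    intro p hp
    obtain ⟨k, hk⟩ := exists_nat_ge |p.2|
    exact Set.mem_iUnion.2 ⟨k, hp, hk.trans (by simp)⟩
  refine measure_mono_null hcover (measure_iUnion_null fun k => ?_)
  refine measure_eq_zero_of_wandering_of_bounded hS hfm hf hf0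
    (hB.inter (measurableSet_le measurable_snd.abs measurable_const))
    (M := k + 1) (by positivity) (fun p hp => hp.2) fun n hn => ?_
  exact measure_mono_null (Set.inter_subset_inter Set.inter_subset_left
    (Set.preimage_mono Set.inter_subset_left)) (hw n hn)

theorem iterate_cylindrical_cascade_ae_eq [SFinite μ] (hS : MeasurePreserving S μ μ)
    {f g : X → ℝ} (hfg : f =ᵐ[μ] g) (n : ℕ) :
    (fun p : X × ℝ => (S p.1, p.2 + f p.1))^[n] =ᵐ[μ.prod volume]
      (fun p : X × ℝ => (S p.1, p.2 + g p.1))^[n] := by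
  have h := Measure.quasiMeasurePreserving_fst (μ := μ) (ν := (volume : Measure ℝ)).ae
    (hS.quasiMeasurePreserving.birkhoffSum_ae_eq_of_ae_eq hfg n)
  filter_upwards [h] with p hp
  rw [iterate_cylindrical_cascade, iterate_cylindrical_cascade, hp]

end Cascade

/-- Krygin–Atkinson: the cylindrical cascade `C(x, r) = (S x, r + f x)` over an
ergodic automorphism `S` of a probability space with an integrable zero-mean
cocycle `f : X → ℝ` is conservative for `μ × Lebesgue`. -/
theorem krygin_atkinson_conservative
    {X : Type*} [MeasurableSpace X]
    (μ : Measure X) [IsProbabilityMeasure μ]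
    (S : X ≃ᵐ X) (hS : MeasurePreserving S μ μ)
    (hSerg : ∀ E : Set X, MeasurableSet E → (⇑S) ⁻¹' E =ᵐ[μ] E →
      μ E = 0 ∨ μ E = 1)
    (f : X → ℝ) (hf : Integrable f μ) (hf0 : ∫ x, f x ∂μ = 0) :
    ∀ B : Set (X × ℝ), MeasurableSet B → 0 < (μ.prod volume) B →
      ∃ n : ℕ, 1 ≤ n ∧
        0 < (μ.prod volume)
          (B ∩ ((fun p : X × ℝ => (S p.1, p.2 + f p.1))^[n]) ⁻¹' B) := by
  intro B hB hpos
  have herg : Ergodic S μ := by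
    refine ⟨hS, ⟨fun E hE hinv => ?_⟩⟩
    rw [eventuallyConst_set']
    rcases hSerg E hE (EventuallyEq.of_eq hinv) with h | h
    · exact Or.inl (ae_eq_empty.2 h)
    · exact Or.inr (ae_eq_univ.2 ((prob_compl_eq_zero_iff hE).2 h))
  by_contra! hcon
  obtain ⟨g, hgm, hfg⟩ := hf.aemeasurable
  refine hpos.ne' (measure_eq_zero_of_wandering herg hgm (hf.congr hfg)
    (by rw [← integral_congr_ae hfg, hf0]) hB fun n hn => ?_)
  rw [← nonpos_iff_eq_zero, ← measure_congr (EventuallyEq.rfl.inter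
    ((iterate_cylindrical_cascade_ae_eq hS hfg n).preimage B))]
  exact hcon n hn
end
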